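/- arXiv:2401.17955 — 15 statements merged into one kernel-verified Lean document; each statement's English description precedes it below -/
import Mathlib

section
/- Let U be an infinite subset of ℤ and let σ : {1, 2, 3, ...} → U be a bijection. For any sequence of integers a_0, a_1, a_2, ..., the function f : U → ℤ defined by f(σ(n)) = Σ_{k=0}^{n-1} a_k · Π_{i=1}^{k} (σ(n) − σ(i)) for every n ≥ 1 is a LIP function on U. (Equivalently, f is given by the formal series f(x) = Σ_{k=0}^{∞} a_k Π_{i=1}^{k} (x − σ(i)), in which all terms with k ≥ σ^{-1}(x) vanish at x ∈ U.) -/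
/-- A function `f` is locally integer polynomial (LIP) on `U ⊆ ℤ` if its restriction
to every finite subset of `U` agrees with some integer polynomial. -/
def IsLIP (U : Set ℤ) (f : ℤ → ℤ) : Prop :=
  ∀ X : Finset ℤ, ↑X ⊆ U → ∃ p : Polynomial ℤ, ∀ x ∈ X, p.eval x = f x

/-- given a bijection `σ` from the positive integers (here indexed by `ℕ`,
starting at 0) onto an infinite set `U ⊆ ℤ`, any formal series
`f(x) = Σ_k a_k Π_{i<k} (x − σ(i))` defines a LIP function on `U`. -/
theorem stmt_1 (U : Set ℤ) (hU : U.Infinite) (σ : ℕ → ℤ)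
    (hσinj : Function.Injective σ) (hσrange : Set.range σ = U)
    (a : ℕ → ℤ) (f : ℤ → ℤ)
    (hf : ∀ n : ℕ, f (σ n) =
      ∑ k ∈ Finset.range (n + 1), a k * ∏ i ∈ Finset.range k, (σ n - σ i)) :
    IsLIP U f := by
  intro X hX
  have hmem : ∀ x ∈ X, ∃ n, σ n = x := fun x hx => by
    have : x ∈ Set.range σ := hσrange ▸ hX hx
    exact this
  choose! g hg using hmem
  refine ⟨∑ k ∈ Finset.range (X.sup g + 1), Polynomial.C (a k) *
    ∏ i ∈ Finset.range k, (Polynomial.X - Polynomial.C (σ i)), fun x hx => ?_⟩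
  have hfx := hf (g x)
  rw [hg x hx] at hfx
  simp only [hfx, Polynomial.eval_finsetSum, Polynomial.eval_mul, Polynomial.eval_C,
    Polynomial.eval_prod, Polynomial.eval_sub, Polynomial.eval_X]
  symm
  refine Finset.sum_subset (Finset.range_subset_range.2 (Nat.succ_le_succ (Finset.le_sup hx)))
    fun k _ hk => ?_
  have hlt : g x < k := by
    rw [Finset.mem_range] at hk
    omega
  rw [Finset.prod_eq_zero (Finset.mem_range.2 hlt) (by rw [hg x hx, sub_self]), mul_zero]
end

section
/- Let U be an infinite subset of ℤ, let σ : {1, 2, 3, ...} → U be a bijection, and let f be a LIP function on U. Then there exists a unique sequence of integers a_0, a_1, a_2, ... such that f(σ(n)) = Σ_{k=0}^{n-1} a_k · Π_{i=1}^{k} (σ(n) − σ(i)) for every n ≥ 1. -/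
/-- Newton expansion of an integer polynomial along a sequence of integer nodes, with remainder. -/
lemma Polynomial.exists_newton_expansion (σ : ℕ → ℤ) (p : Polynomial ℤ) (N : ℕ) :
    ∃ (a : ℕ → ℤ) (q : Polynomial ℤ), ∀ x : ℤ, p.eval x =
      ∑ k ∈ Finset.range N, a k * ∏ i ∈ Finset.range k, (x - σ i) +
        q.eval x * ∏ i ∈ Finset.range N, (x - σ i) := by
  induction N generalizing p σ with
  | zero => exact ⟨0, p, fun x => by simp⟩
  | succ N ih =>
    obtain ⟨q, hq⟩ := Polynomial.X_sub_C_dvd_sub_C_eval (a := σ 0) (p := p)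
    obtain ⟨b, r, hb⟩ := ih (fun i => σ (i + 1)) q
    refine ⟨fun k => k.casesOn (p.eval (σ 0)) b, r, fun x => ?_⟩
    have hx : p.eval x - p.eval (σ 0) = (x - σ 0) * q.eval x := by
      simpa using congrArg (Polynomial.eval x) hq
    rw [Finset.sum_range_succ', eq_add_of_sub_eq hx, hb x]
    simp only [Finset.prod_range_succ', Finset.prod_range_zero, mul_add, Finset.mul_sum, mul_one]
    rw [add_right_comm]
    congr 1
    · congr 1
      · exact Finset.sum_congr rfl fun k _ => by ring
    · ring

/-- The Newton coefficients along an injective sequence are determined by the values. -/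
lemma newton_coeff_unique {σ : ℕ → ℤ} (hσ : Function.Injective σ) {a b : ℕ → ℤ} {g : ℕ → ℤ}
    {N : ℕ}
    (ha : ∀ n < N, g n =
      ∑ k ∈ Finset.range (n + 1), a k * ∏ i ∈ Finset.range k, (σ n - σ i))
    (hb : ∀ n < N, g n =
      ∑ k ∈ Finset.range (n + 1), b k * ∏ i ∈ Finset.range k, (σ n - σ i)) :
    ∀ n < N, a n = b n := by
  intro n
  induction n using Nat.strong_induction_on with
  | _ n ih =>
    intro hn
    have h := (ha n hn).symm.trans (hb n hn)
    have hsum : ∑ k ∈ Finset.range n, a k * ∏ i ∈ Finset.range k, (σ n - σ i) =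
        ∑ k ∈ Finset.range n, b k * ∏ i ∈ Finset.range k, (σ n - σ i) :=
      Finset.sum_congr rfl fun k hk => by
        have hk := Finset.mem_range.1 hk
        rw [ih k hk (hk.trans hn)]
    rw [Finset.sum_range_succ, Finset.sum_range_succ, hsum] at h
    refine mul_right_cancel₀ (Finset.prod_ne_zero_iff.2 fun i hi => ?_) (add_left_cancel h)
    exact sub_ne_zero.2 (hσ.ne (Finset.mem_range.1 hi).ne')

lemma IsLIP.exists_newton_coeff {U : Set ℤ} {f : ℤ → ℤ} (hf : IsLIP U f) {σ : ℕ → ℤ}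
    (hσ : Set.range σ ⊆ U) (N : ℕ) :
    ∃ a : ℕ → ℤ, ∀ n < N, f (σ n) =
      ∑ k ∈ Finset.range (n + 1), a k * ∏ i ∈ Finset.range k, (σ n - σ i) := by
  obtain ⟨p, hp⟩ := hf ((Finset.range N).image σ) (by
    intro x hx
    obtain ⟨i, -, rfl⟩ := Finset.mem_image.1 (Finset.mem_coe.1 hx)
    exact hσ ⟨i, rfl⟩)
  obtain ⟨a, q, h⟩ := p.exists_newton_expansion σ N
  refine ⟨a, fun n hn => ?_⟩
  have hzero : ∀ k, n < k → ∏ i ∈ Finset.range k, (σ n - σ i) = 0 := fun k hk =>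
    Finset.prod_eq_zero (Finset.mem_range.2 hk) (sub_self _)
  rw [← hp _ (Finset.mem_image_of_mem σ (Finset.mem_range.2 hn)), h, hzero N hn, mul_zero,
    add_zero]
  refine (Finset.sum_subset (Finset.range_mono hn) fun k _ hk => ?_).symm
  rw [hzero k (by simpa using hk), mul_zero]

/-- given a bijection `σ` from the positive integers (here indexed by `ℕ`,
starting at 0) onto an infinite set `U ⊆ ℤ` and a LIP function `f` on `U`, there is a
unique sequence of integers `a` with `f(σ(n)) = Σ_{k≤n} a_k Π_{i<k} (σ(n) − σ(i))`
for every `n`. -/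
theorem stmt_2 (U : Set ℤ) (hU : U.Infinite) (σ : ℕ → ℤ)
    (hσinj : Function.Injective σ) (hσrange : Set.range σ = U)
    (f : ℤ → ℤ) (hf : IsLIP U f) :
    ∃! a : ℕ → ℤ, ∀ n : ℕ, f (σ n) =
      ∑ k ∈ Finset.range (n + 1), a k * ∏ i ∈ Finset.range k, (σ n - σ i) := by
  choose A hA using hf.exists_newton_coeff hσrange.subset
  refine ⟨fun n => A (n + 1) n, fun n => ?_, fun b hb => funext fun n => ?_⟩
  · rw [hA (n + 1) n n.lt_succ_self]
    refine Finset.sum_congr rfl fun k hk => ?_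
    have hk := Finset.mem_range.1 hk
    rw [newton_coeff_unique hσinj (g := fun m => f (σ m)) (N := k + 1)
      (fun m hm => hA (n + 1) m (by omega)) (hA (k + 1)) k k.lt_succ_self]
  · exact newton_coeff_unique hσinj (g := fun m => f (σ m)) (fun m _ => hb m) (hA (n + 1)) n
      n.lt_succ_self
end

section
/- Let U be an infinite subset of ℤ and let f be a LIP function on U. If f(x) = 0 for infinitely many x ∈ U, then f(x) = 0 for all x ∈ U. -/
/-- a LIP function on an infinite set `U ⊆ ℤ` vanishing at infinitely
many points of `U` vanishes identically on `U`. -/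
theorem stmt_3 (U : Set ℤ) (hU : U.Infinite) (f : ℤ → ℤ) (hf : IsLIP U f)
    (h0 : {x ∈ U | f x = 0}.Infinite) : ∀ x ∈ U, f x = 0 := by
  intro a ha
  obtain ⟨x, ⟨hxU, hx⟩, hfar⟩ :=
    h0.exists_notMem_finset (Finset.Icc (a - |f a|) (a + |f a|))
  obtain ⟨p, hp⟩ := hf {a, x} (by simp [Set.insert_subset_iff, ha, hxU])
  have hdvd : a - x ∣ f a := by
    have h := p.sub_dvd_eval_sub a x
    rwa [hp a (by simp), hp x (by simp), hx, sub_zero] at h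
  refine Int.eq_zero_of_abs_lt_dvd ((abs_dvd _ _).2 hdvd) ?_
  rw [Finset.mem_Icc] at hfar
  contrapose! hfar
  have h := abs_le.1 hfar
  constructor <;> linarith
end

section
/- Let U be an infinite subset of ℤ and let f and g be LIP functions on U. Then: (1) if f(x)·g(x) = 0 for all x ∈ U, then f is identically 0 on U or g is identically 0 on U; and (2) if f(x)·g(x) = 1 for all x ∈ U, then f is identically 1 on U or f is identically −1 on U. In other words, the ring LIP(U) is an integral domain whose only units are the constant functions 1 and −1. -/
/-- LIP functions preserve congruences. -/
theorem IsLIP.sub_dvd_sub {U : Set ℤ} {f : ℤ → ℤ} (hf : IsLIP U f) {x y : ℤ}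
    (hx : x ∈ U) (hy : y ∈ U) : x - y ∣ f x - f y := by
  obtain ⟨p, hp⟩ := hf {x, y} (by simp [Set.insert_subset_iff, hx, hy])
  rw [← hp x (by simp), ← hp y (by simp)]
  exact Polynomial.sub_dvd_eval_sub x y p

/-- If two values of a LIP function differ, the distance of the arguments is at most
the distance of the values. -/
theorem IsLIP.abs_sub_le {U : Set ℤ} {f : ℤ → ℤ} (hf : IsLIP U f) {x y : ℤ}
    (hx : x ∈ U) (hy : y ∈ U) (h : f x ≠ f y) : |x - y| ≤ |f x - f y| :=
  Int.le_of_dvd (abs_pos.2 (sub_ne_zero.2 h))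
    ((abs_dvd_abs _ _).2 (hf.sub_dvd_sub hx hy))

/-- An infinite set of integers contains elements of arbitrarily large absolute value. -/
theorem Set.Infinite.exists_lt_abs {U : Set ℤ} (hU : U.Infinite) (N : ℤ) :
    ∃ x ∈ U, N < |x| := by
  obtain ⟨x, hxU, hx⟩ := hU.exists_notMem_finset (Finset.Icc (-N) N)
  exact ⟨x, hxU, not_le.1 fun h => hx (Finset.mem_Icc.2 (abs_le.1 h))⟩

/-- `LIP(U)` is an integral domain whose only units are `±1`:
(1) if a product of two LIP functions vanishes on `U`, one of them vanishes on `U`;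
(2) if a product of two LIP functions is `1` on `U`, the first factor is
identically `1` or identically `−1` on `U`. -/
theorem stmt_4 (U : Set ℤ) (hU : U.Infinite) (f g : ℤ → ℤ)
    (hf : IsLIP U f) (hg : IsLIP U g) :
    ((∀ x ∈ U, f x * g x = 0) → (∀ x ∈ U, f x = 0) ∨ (∀ x ∈ U, g x = 0)) ∧
    ((∀ x ∈ U, f x * g x = 1) → (∀ x ∈ U, f x = 1) ∨ (∀ x ∈ U, f x = -1)) := by
  constructor
  · intro h
    by_contra! hne
    obtain ⟨⟨a, ha, hfa⟩, b, hb, hgb⟩ := hne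
    obtain ⟨x, hx, hlt⟩ := hU.exists_lt_abs (|a| + |f a| + |b| + |g b|)
    rcases mul_eq_zero.1 (h x hx) with h0 | h0
    · have := hf.abs_sub_le hx ha (h0.trans_ne hfa.symm)
      rw [h0] at this
      grind
    · have := hg.abs_sub_le hx hb (h0.trans_ne hgb.symm)
      rw [h0] at this
      grind
  · intro h
    have hunit : ∀ x ∈ U, f x = 1 ∨ f x = -1 := fun x hx =>
      Int.isUnit_iff.1 (.of_mul_eq_one _ (h x hx))
    by_contra! hne
    obtain ⟨⟨a, ha, hfa⟩, b, hb, hfb⟩ := hne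
    obtain ⟨x, hx, hlt⟩ := hU.exists_lt_abs (|a| + |b| + 2)
    have ha' := (hunit a ha).resolve_left hfa
    have hb' := (hunit b hb).resolve_right hfb
    rcases hunit x hx with h1 | h1
    · have := hf.abs_sub_le hx ha (by omega)
      rw [h1, ha'] at this
      grind
    · have := hf.abs_sub_le hx hb (by omega)
      rw [h1, hb'] at this
      grind
end

section
/- Let U be an infinite subset of ℤ, let C be a real number, let d be a natural number, and let f be a LIP function on U. If the set {x ∈ U : |f(x)| ≤ C·|x|^d} is infinite, then there exists a polynomial p with integer coefficients such that f(x) = p(x) for all x ∈ U. -/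
open Polynomial in
/-- An integer polynomial of degree at most `d` is `O(|y| ^ d)` on the nonzero integers. -/
theorem Polynomial.exists_abs_eval_le_mul_abs_pow (p : ℤ[X]) {d : ℕ} (hp : p.natDegree ≤ d) :
    ∃ B : ℤ, ∀ y : ℤ, y ≠ 0 → |p.eval y| ≤ B * |y| ^ d := by
  refine ⟨∑ i ∈ Finset.range (d + 1), |p.coeff i|, fun y hy => ?_⟩
  rw [eval_eq_sum_range' (Nat.lt_succ_of_le hp), Finset.sum_mul]
  refine (Finset.abs_sum_le_sum_abs _ _).trans (Finset.sum_le_sum fun i hi => ?_)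
  rw [abs_mul, abs_pow]
  exact mul_le_mul_of_nonneg_left
    (pow_le_pow_right₀ (Int.one_le_abs hy) (Finset.mem_range_succ_iff.mp hi)) (abs_nonneg _)

open Polynomial in
/-- A monic integer polynomial of degree `d + 1` eventually dominates `K * |y| ^ d`. -/
theorem Polynomial.Monic.finite_setOf_abs_eval_le {P : ℤ[X]} (hP : P.Monic) {d : ℕ}
    (hd : P.natDegree = d + 1) (K : ℤ) : {y : ℤ | |P.eval y| ≤ K * |y| ^ d}.Finite := by
  obtain ⟨B, hB⟩ := P.eraseLead.exists_abs_eval_le_mul_abs_pow (d := d)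
    (by have := P.eraseLead_natDegree_le; omega)
  refine (Set.finite_Icc (-|K + B|) |K + B|).subset fun y hy => ?_
  rw [Set.mem_Icc, ← abs_le]
  rcases eq_or_ne y 0 with rfl | hy0
  · simp
  have hsplit : P.eval y = P.eraseLead.eval y + y ^ (d + 1) := by
    conv_lhs => rw [← P.eraseLead_add_C_mul_X_pow]
    simp [hP.leadingCoeff, hd]
  have hpow : |y| ^ (d + 1) ≤ (K + B) * |y| ^ d := by
    have hle : |y ^ (d + 1)| ≤ |P.eval y| + |P.eraseLead.eval y| := by
      rw [show y ^ (d + 1) = P.eval y - P.eraseLead.eval y by rw [hsplit]; ring]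
      exact abs_sub _ _
    rw [abs_pow] at hle
    have h₁ := hB y hy0
    have h₂ : |P.eval y| ≤ K * |y| ^ d := hy
    linarith
  rw [pow_succ'] at hpow
  exact (le_of_mul_le_mul_right hpow (pow_pos (abs_pos.mpr hy0) d)).trans (le_abs_self _)

open Polynomial in
/-- If two integer polynomials agree on a finite set `X`, then `∏ x ∈ X, (T - x)` divides their
difference. -/
theorem Polynomial.prod_X_sub_C_dvd_sub_of_eval_eq {p q : ℤ[X]} (X : Finset ℤ)
    (h : ∀ x ∈ X, p.eval x = q.eval x) :
    (∏ x ∈ X, (Polynomial.X - C x)) ∣ p - q := by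
  rcases eq_or_ne (p - q) 0 with h0 | h0
  · simp [h0]
  refine (Multiset.prod_X_sub_C_dvd_iff_le_roots h0 X.val).mpr ?_
  refine (Multiset.le_iff_subset X.nodup).mpr fun x hx => ?_
  rw [mem_roots h0, IsRoot, eval_sub, h x hx, sub_self]

/-- if `f ∈ LIP(U)` satisfies `|f(x)| ≤ C|x|^d` for infinitely many
`x ∈ U`, then `f` is given by an integer polynomial on `U`. -/
theorem stmt_6 (U : Set ℤ) (hU : U.Infinite) (C : ℝ) (d : ℕ) (f : ℤ → ℤ)
    (hf : IsLIP U f)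
    (h : {x ∈ U | |(f x : ℝ)| ≤ C * |(x : ℝ)| ^ d}.Infinite) :
    ∃ p : Polynomial ℤ, ∀ x ∈ U, p.eval x = f x := by
  obtain ⟨X, hXU, hXcard⟩ := hU.exists_subset_card_eq (d + 1)
  obtain ⟨q₀, hq₀⟩ := hf X hXU
  set P : Polynomial ℤ := ∏ x ∈ X, (Polynomial.X - Polynomial.C x) with hPdef
  have hP : P.Monic := Polynomial.monic_prod_of_monic _ _ fun x _ => Polynomial.monic_X_sub_C x
  have hdeg : P.natDegree = d + 1 := by
    rw [hPdef, Polynomial.natDegree_finsetProd_X_sub_C_eq_card, hXcard]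
  set p := q₀ %ₘ P with hp
  have hp_deg : p.natDegree ≤ d := by
    have : p.natDegree < P.natDegree :=
      Polynomial.natDegree_modByMonic_lt q₀ hP (by rintro h1; simp [h1] at hdeg)
    omega
  have hdvd : ∀ y ∈ U, P.eval y ∣ f y - p.eval y := by
    intro y hy
    obtain ⟨q, hq⟩ := hf (insert y X) (by
      rw [Finset.coe_insert]; exact Set.insert_subset hy hXU)
    have h₁ : P ∣ q - q₀ := Polynomial.prod_X_sub_C_dvd_sub_of_eval_eq X fun x hx => by
      rw [hq x (Finset.mem_insert_of_mem hx), hq₀ x hx]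
    have h₂ : P ∣ q₀ - p := ⟨q₀ /ₘ P, by
      rw [sub_eq_iff_eq_add', hp, Polynomial.modByMonic_add_div]⟩
    have h₃ := Polynomial.eval_dvd (x := y) (dvd_add h₁ h₂)
    rwa [sub_add_sub_cancel, Polynomial.eval_sub, hq y (Finset.mem_insert_self y X)] at h₃
  obtain ⟨B, hB⟩ := p.exists_abs_eval_le_mul_abs_pow hp_deg
  have hinf : {y ∈ U | p.eval y = f y}.Infinite := by
    refine (h.sdiff ((hP.finite_setOf_abs_eval_le hdeg (⌈C⌉ + B)).union
      (Set.finite_singleton 0))).mono ?_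
    rintro y ⟨⟨hyU, hyC⟩, hy⟩
    rw [Set.mem_union, not_or, Set.mem_ofPred_eq, not_le, Set.mem_singleton_iff] at hy
    have hfy : |f y| ≤ ⌈C⌉ * |y| ^ d := by
      have : |(f y : ℝ)| ≤ ⌈C⌉ * |(y : ℝ)| ^ d :=
        hyC.trans (mul_le_mul_of_nonneg_right (Int.le_ceil C) (by positivity))
      exact_mod_cast this
    refine ⟨hyU, (sub_eq_zero.mp (Int.eq_zero_of_abs_lt_dvd ((abs_dvd _ _).mpr (hdvd y hyU))
      (lt_of_le_of_lt ?_ hy.1))).symm⟩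
    linarith [abs_sub (f y) (p.eval y), hB y hy.2]
  refine ⟨p, fun z hz => ?_⟩
  obtain ⟨y, ⟨hyU, hy⟩, hy_large⟩ := hinf.exists_notMem_finite
    (Set.finite_Icc (z - |f z - p.eval z|) (z + |f z - p.eval z|))
  obtain ⟨q, hq⟩ := hf {y, z} (by
    rw [Finset.coe_pair]; exact Set.pair_subset hyU hz)
  have hzy : z - y ∣ f z - p.eval z := by
    have := Polynomial.sub_dvd_eval_sub z y (q - p)
    rwa [Polynomial.eval_sub, Polynomial.eval_sub, hq z (by simp), hq y (by simp), hy, sub_self,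
      sub_zero] at this
  refine (sub_eq_zero.mp (Int.eq_zero_of_abs_lt_dvd ((abs_dvd _ _).mpr hzy) ?_)).symm
  contrapose! hy_large
  rw [abs_le] at hy_large
  exact ⟨by linarith, by linarith⟩
end

section
/- Let U be an infinite subset of ℤ and let f be a LIP function on U. Suppose there exists a nonzero polynomial P in one variable y with coefficients in ℤ[x], say P = Σ_{j=0}^{n} p_j(x)·y^j with p_j ∈ ℤ[x] not all zero, such that Σ_{j=0}^{n} p_j(x)·f(x)^j = 0 for all x ∈ U. Then there exists a polynomial q with integer coefficients such that f(x) = q(x) for all x ∈ U. In other words, ℤ[x] is algebraically closed in LIP(U). -/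
open Polynomial in
theorem Polynomial.exists_abs_eval_le (q : ℤ[X]) {d : ℕ} (hd : q.natDegree ≤ d) :
    ∃ C : ℤ, 0 ≤ C ∧ ∀ x : ℤ, |q.eval x| ≤ C * (1 + |x|) ^ d := by
  refine ⟨∑ i ∈ Finset.range (d + 1), |q.coeff i|,
    Finset.sum_nonneg fun _ _ => abs_nonneg _, fun x => ?_⟩
  rw [q.eval_eq_sum_range' (Nat.lt_succ_of_le hd), Finset.sum_mul]
  refine (Finset.abs_sum_le_sum_abs _ _).trans (Finset.sum_le_sum fun i hi => ?_)
  rw [abs_mul, abs_pow]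
  have hx := abs_nonneg x
  have hi' : i ≤ d := Nat.lt_succ_iff.mp (Finset.mem_range.mp hi)
  gcongr
  calc |x| ^ i ≤ (1 + |x|) ^ i := by gcongr; linarith
    _ ≤ (1 + |x|) ^ d := pow_le_pow_right₀ (by linarith) hi'

/-- An integer root of a polynomial with nonzero leading coefficient is bounded by the
coefficients. -/
theorem abs_le_of_sum_mul_pow_eq_zero (m : ℕ) (c : ℕ → ℤ) (y : ℤ) (hc : c m ≠ 0)
    (h : ∑ j ∈ Finset.range (m + 1), c j * y ^ j = 0) :
    |y| ≤ ∑ j ∈ Finset.range (m + 1), |c j| := by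
  have hcm : 1 ≤ |c m| := Int.one_le_abs hc
  rw [Finset.sum_range_succ] at h ⊢
  have hS : 0 ≤ ∑ j ∈ Finset.range m, |c j| := Finset.sum_nonneg fun _ _ => abs_nonneg _
  rcases le_or_gt |y| 1 with hy | hy
  · linarith
  rcases m with _ | m
  · simp_all
  have hpos : 0 < |y| ^ m := by positivity
  have key : |y| * |y| ^ m ≤ (∑ j ∈ Finset.range (m + 1), |c j|) * |y| ^ m := by
    calc |y| * |y| ^ m = 1 * |y| ^ (m + 1) := by ring
      _ ≤ |c (m + 1)| * |y| ^ (m + 1) := by gcongr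
      _ = |∑ j ∈ Finset.range (m + 1), c j * y ^ j| := by
        rw [← abs_pow, ← abs_mul, eq_neg_of_add_eq_zero_left h, abs_neg]
      _ ≤ ∑ j ∈ Finset.range (m + 1), |c j * y ^ j| := Finset.abs_sum_le_sum_abs _ _
      _ ≤ ∑ j ∈ Finset.range (m + 1), |c j| * |y| ^ m := by
        refine Finset.sum_le_sum fun j hj => ?_
        rw [abs_mul, abs_pow]
        have hj' : j ≤ m := Nat.lt_succ_iff.mp (Finset.mem_range.mp hj)
        gcongr
        exact hy.le
      _ = _ := by rw [Finset.sum_mul]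
  have := le_of_mul_le_mul_right key hpos
  linarith

/-- A function algebraic over `ℤ[x]` has polynomial growth off a finite set. -/
theorem exists_abs_le_of_algebraic (U : Set ℤ) (f : ℤ → ℤ) (n : ℕ) (p : ℕ → Polynomial ℤ)
    (hne : ∃ j ≤ n, p j ≠ 0)
    (h : ∀ x ∈ U, ∑ j ∈ Finset.range (n + 1), (p j).eval x * (f x) ^ j = 0) :
    ∃ (d : ℕ) (C : ℤ) (B : Finset ℤ), 0 ≤ C ∧ ∀ x ∈ U, x ∉ B → |f x| ≤ C * (1 + |x|) ^ d := by
  induction n with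
  | zero =>
    obtain ⟨j, hj, hpj⟩ := hne
    obtain rfl : j = 0 := by omega
    refine ⟨0, 0, (p 0).roots.toFinset, le_rfl, fun x hx hxB => ?_⟩
    have h0 := h x hx
    simp_all
  | succ n ih =>
    by_cases hp : p (n + 1) = 0
    · refine ih ?_ fun x hx => ?_
      · obtain ⟨j, hj, hpj⟩ := hne
        exact ⟨j, Nat.lt_succ_iff.mp (lt_of_le_of_ne hj (by rintro rfl; exact hpj hp)), hpj⟩
      · simpa [Finset.sum_range_succ _ (n + 1), hp] using h x hx
    · set d := (Finset.range (n + 2)).sup fun j => (p j).natDegree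
      have hC (j : ℕ) : ∃ C : ℤ, 0 ≤ C ∧
          (j ∈ Finset.range (n + 2) → ∀ x : ℤ, |(p j).eval x| ≤ C * (1 + |x|) ^ d) := by
        by_cases hj : j ∈ Finset.range (n + 2)
        · obtain ⟨C, hC0, hC⟩ := (p j).exists_abs_eval_le
            (Finset.le_sup (f := fun j => (p j).natDegree) hj)
          exact ⟨C, hC0, fun _ => hC⟩
        · exact ⟨0, le_rfl, fun hj' => absurd hj' hj⟩
      choose C hC0 hC using hC
      refine ⟨d, ∑ j ∈ Finset.range (n + 2), C j, (p (n + 1)).roots.toFinset,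
        Finset.sum_nonneg fun j _ => hC0 j, fun x hx hxB => ?_⟩
      refine (abs_le_of_sum_mul_pow_eq_zero (n + 1) (fun j => (p j).eval x) (f x) ?_
        (h x hx)).trans ?_
      · simpa [hp] using hxB
      · rw [Finset.sum_mul]
        exact Finset.sum_le_sum fun j hj => hC j hj x

/-- A LIP function takes values divisible by `∏ (x - a)` after subtracting an
interpolating polynomial. -/
theorem IsLIP.prod_dvd_sub {U : Set ℤ} {f : ℤ → ℤ} (hf : IsLIP U f) {A : Finset ℤ}
    (hA : ↑A ⊆ U) {q : Polynomial ℤ} (hq : ∀ a ∈ A, q.eval a = f a) {x : ℤ} (hx : x ∈ U) :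
    ∏ a ∈ A, (x - a) ∣ f x - q.eval x := by
  obtain ⟨r, hr⟩ := hf (insert x A) (by
    rw [Finset.coe_insert]; exact Set.insert_subset hx hA)
  have hdvd : ∏ a ∈ A, (Polynomial.X - Polynomial.C a) ∣ r - q := by
    rw [Finset.prod_eq_multiset_prod]
    by_cases h0 : r - q = 0
    · rw [h0]; exact dvd_zero _
    · rw [Multiset.prod_X_sub_C_dvd_iff_le_roots h0, Multiset.le_iff_subset A.nodup]
      intro a ha
      rw [Polynomial.mem_roots h0, Polynomial.IsRoot, Polynomial.eval_sub, hq a ha,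
        hr a (Finset.mem_insert_of_mem ha), sub_self]
  have := Polynomial.eval_dvd (x := x) hdvd
  simpa [Polynomial.eval_prod, hr x (Finset.mem_insert_self x A)] using this

theorem IsLIP.exists_interpolation {U : Set ℤ} {f : ℤ → ℤ} (hf : IsLIP U f) {A : Finset ℤ}
    (hA : ↑A ⊆ U) {d : ℕ} (hcard : A.card = d + 1) :
    ∃ q : Polynomial ℤ, q.natDegree ≤ d ∧ ∀ a ∈ A, q.eval a = f a := by
  obtain ⟨r, hr⟩ := hf A hA
  have hmonic : (∏ a ∈ A, (Polynomial.X - Polynomial.C a)).Monic :=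
    Polynomial.monic_prod_of_monic _ _ fun a _ => Polynomial.monic_X_sub_C a
  have hdeg : (∏ a ∈ A, (Polynomial.X - Polynomial.C a)).natDegree = d + 1 := by
    rw [Polynomial.natDegree_prod_of_monic _ _ fun a _ => Polynomial.monic_X_sub_C a]
    simp only [Polynomial.natDegree_X_sub_C, Finset.sum_const, smul_eq_mul, mul_one, hcard]
  refine ⟨r %ₘ ∏ a ∈ A, (Polynomial.X - Polynomial.C a), ?_, fun a ha => ?_⟩
  · have := Polynomial.natDegree_modByMonic_lt r hmonic (by
      intro h1; rw [h1, Polynomial.natDegree_one] at hdeg; omega)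
    omega
  · rw [← hr a ha, Polynomial.modByMonic_eq_sub_mul_div, Polynomial.eval_sub,
      Polynomial.eval_mul, Polynomial.eval_prod, Finset.prod_eq_zero ha (by simp)]
    simp

theorem exists_pow_le_abs_prod_sub (A : Finset ℤ) :
    ∃ K : ℤ, ∀ x : ℤ, K < |x| →
      (1 + |x|) ^ A.card ≤ 2 ^ A.card * |∏ a ∈ A, (x - a)| := by
  refine ⟨2 * ∑ a ∈ A, |a|, fun x hx => ?_⟩
  rw [Finset.abs_prod, ← Finset.prod_const, ← Finset.prod_const, ← Finset.prod_mul_distrib]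
  refine Finset.prod_le_prod (fun _ _ => by positivity) fun a ha => ?_
  have h1 : |a| ≤ ∑ a ∈ A, |a| :=
    Finset.single_le_sum (f := fun a : ℤ => |a|) (fun _ _ => abs_nonneg _) ha
  have h2 := abs_sub_abs_le_abs_sub x a
  linarith

theorem finite_setOf_abs_le (K : ℤ) : {x : ℤ | |x| ≤ K}.Finite :=
  (Set.finite_Icc (-K) K).subset fun _ hx => abs_le.mp hx

/-- A LIP function agreeing with a polynomial on an infinite subset agrees with it
everywhere. -/
theorem IsLIP.eval_eq_of_infinite {U V : Set ℤ} {f : ℤ → ℤ} (hf : IsLIP U f) (hVU : V ⊆ U)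
    (hV : V.Infinite) {q : Polynomial ℤ} (hq : ∀ x ∈ V, q.eval x = f x) :
    ∀ x ∈ U, q.eval x = f x := by
  intro y hy
  obtain ⟨x, hxV, hx⟩ := hV.exists_notMem_finite
    (finite_setOf_abs_le (|f y - q.eval y| + |y|))
  have hdvd := hf.prod_dvd_sub (A := {x}) (by simpa using hVU hxV) (q := q)
    (by simpa using hq x hxV) hy
  rw [Finset.prod_singleton] at hdvd
  have hlt : |f y - q.eval y| < |y - x| := by
    have h1 := abs_sub_abs_le_abs_sub x y
    rw [abs_sub_comm x y] at h1
    simp only [Set.mem_ofPred_eq, not_le] at hx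
    linarith
  have := Int.eq_zero_of_abs_lt_dvd ((abs_dvd _ _).mpr hdvd) hlt
  linarith

/-- `ℤ[x]` is algebraically closed in `LIP(U)`: if `f ∈ LIP(U)`
satisfies a nontrivial polynomial equation `Σ_j p_j(x) f(x)^j = 0` with
coefficients `p_j ∈ ℤ[x]`, not all zero, then `f` agrees on `U` with an
integer polynomial. -/
theorem stmt_8 (U : Set ℤ) (hU : U.Infinite) (f : ℤ → ℤ) (hf : IsLIP U f)
    (n : ℕ) (p : ℕ → Polynomial ℤ) (hne : ∃ j ≤ n, p j ≠ 0)
    (h : ∀ x ∈ U, ∑ j ∈ Finset.range (n + 1), (p j).eval x * (f x) ^ j = 0) :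
    ∃ q : Polynomial ℤ, ∀ x ∈ U, q.eval x = f x := by
  obtain ⟨d, C, B, hC0, hC⟩ := exists_abs_le_of_algebraic U f n p hne h
  obtain ⟨A, hAU, hA⟩ := hU.exists_subset_card_eq (d + 1)
  obtain ⟨q, hqd, hq⟩ := hf.exists_interpolation hAU hA
  obtain ⟨D, hD0, hD⟩ := q.exists_abs_eval_le hqd
  obtain ⟨K, hK⟩ := exists_pow_le_abs_prod_sub A
  refine ⟨q, hf.eval_eq_of_infinite (V := U \ (↑B ∪ {x | |x| ≤ max K (2 ^ (d + 1) * (C + D))}))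
    Set.sdiff_subset (hU.sdiff (B.finite_toSet.union (finite_setOf_abs_le _))) ?_⟩
  rintro x ⟨hxU, hx⟩
  simp only [Set.mem_union, Finset.mem_coe, Set.mem_ofPred_eq, not_or, not_le, max_lt_iff] at hx
  obtain ⟨hxB, hxK, hxC⟩ := hx
  by_contra hne'
  have hg : f x - q.eval x ≠ 0 := fun h0 => hne' (sub_eq_zero.mp h0).symm
  have hle : |∏ a ∈ A, (x - a)| ≤ |f x - q.eval x| :=
    Int.le_of_dvd (abs_pos.mpr hg) ((abs_dvd_abs _ _).mpr (hf.prod_dvd_sub hAU hq hxU))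
  have hKx := hK x hxK
  rw [hA] at hKx
  have hpos : 0 < (1 + |x|) ^ d := by positivity
  have key : (1 + |x|) * (1 + |x|) ^ d ≤ 2 ^ (d + 1) * (C + D) * (1 + |x|) ^ d := by
    calc (1 + |x|) * (1 + |x|) ^ d = (1 + |x|) ^ (d + 1) := by ring
      _ ≤ 2 ^ (d + 1) * |∏ a ∈ A, (x - a)| := hKx
      _ ≤ 2 ^ (d + 1) * (|f x| + |q.eval x|) := by
        gcongr
        exact hle.trans (abs_sub _ _)
      _ ≤ 2 ^ (d + 1) * (C * (1 + |x|) ^ d + D * (1 + |x|) ^ d) := by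
        gcongr
        · exact hC x hxU hxB
        · exact hD x
      _ = _ := by ring
  have := le_of_mul_le_mul_right key hpos
  linarith
end

section
/- Let U be an infinite subset of ℤ. Then the ring LIP(U) contains an infinite strictly increasing chain of principal ideals: there exists a sequence f_1, f_2, f_3, ... of LIP functions on U such that for every m ≥ 1 there is a LIP function g on U with f_m(x) = f_{m+1}(x)·g(x) for all x ∈ U, but there is no LIP function h on U with f_{m+1}(x) = f_m(x)·h(x) for all x ∈ U. In particular, LIP(U) is not Noetherian. -/
open Polynomial in
/-- A polynomial taking the value `1` at every integer of absolute value at most `i`,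
and a non-unit value at every other integer. -/
noncomputable def ballOnePoly (i : ℕ) : ℤ[X] :=
  1 + 3 * ∏ t ∈ Finset.Icc (-i : ℤ) i, (X - C t)

theorem eval_ballOnePoly (i : ℕ) (x : ℤ) :
    (ballOnePoly i).eval x = 1 + 3 * ∏ t ∈ Finset.Icc (-i : ℤ) i, (x - t) := by
  simp [ballOnePoly, Polynomial.eval_prod]

theorem eval_ballOnePoly_of_le {i : ℕ} {x : ℤ} (h : x.natAbs ≤ i) :
    (ballOnePoly i).eval x = 1 := by
  rw [eval_ballOnePoly, Finset.prod_eq_zero (i := x) (Finset.mem_Icc.2 (by omega)) (sub_self x)]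
  norm_num

theorem eval_ballOnePoly_ne_zero (i : ℕ) (x : ℤ) : (ballOnePoly i).eval x ≠ 0 := by
  rw [eval_ballOnePoly]
  omega

theorem not_isUnit_eval_ballOnePoly {i : ℕ} {x : ℤ} (h : i < x.natAbs) :
    ¬ IsUnit ((ballOnePoly i).eval x) := by
  have hN : ∏ t ∈ Finset.Icc (-i : ℤ) i, (x - t) ≠ 0 := by
    refine Finset.prod_ne_zero_iff.2 fun t ht => ?_
    rw [Finset.mem_Icc] at ht
    omega
  rw [eval_ballOnePoly, Int.isUnit_iff]
  omega

/-- The pointwise-finite product `∏_{i ≥ m} ballOnePoly i`. -/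
noncomputable def tailProd (m : ℕ) (x : ℤ) : ℤ :=
  ∏ i ∈ Finset.Ico m x.natAbs, (ballOnePoly i).eval x

theorem tailProd_ne_zero (m : ℕ) (x : ℤ) : tailProd m x ≠ 0 :=
  Finset.prod_ne_zero_iff.2 fun i _ => eval_ballOnePoly_ne_zero i x

theorem tailProd_eq_mul (m : ℕ) (x : ℤ) :
    tailProd m x = tailProd (m + 1) x * (ballOnePoly m).eval x := by
  rcases lt_or_ge m x.natAbs with h | h
  · rw [tailProd, Finset.prod_eq_prod_Ico_succ_bot h, mul_comm, tailProd]
  · simp [tailProd, Finset.Ico_eq_empty_of_le h, Finset.Ico_eq_empty_of_le (h.trans m.le_succ),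
      eval_ballOnePoly_of_le h]

theorem isLIP_eval (U : Set ℤ) (p : Polynomial ℤ) : IsLIP U fun x => p.eval x :=
  fun _ _ => ⟨p, fun _ _ => rfl⟩

theorem isLIP_tailProd (U : Set ℤ) (m : ℕ) : IsLIP U (tailProd m) := by
  intro X _
  refine ⟨∏ i ∈ Finset.Ico m (X.sup Int.natAbs), ballOnePoly i, fun x hx => ?_⟩
  rw [Polynomial.eval_prod, tailProd]
  refine (Finset.prod_subset (Finset.Ico_subset_Ico_right (Finset.le_sup hx)) ?_).symm
  intro i hi hi'
  rw [Finset.mem_Ico] at hi hi'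
  exact eval_ballOnePoly_of_le (by omega)

theorem Set.Infinite.exists_lt_natAbs {U : Set ℤ} (hU : U.Infinite) (m : ℕ) :
    ∃ x ∈ U, m < x.natAbs := by
  by_contra! h
  refine hU ((Set.finite_Icc (-m : ℤ) m).subset fun x hx => ?_)
  have := h x hx
  rw [Set.mem_Icc]
  omega

/-- `LIP(U)` contains an infinite strictly increasing chain of
principal ideals: there are LIP functions `f_1, f_2, …` such that each `f_m` is a
multiple of `f_{m+1}` by a LIP function, but `f_{m+1}` is not a multiple of `f_m`
by any LIP function. In particular, `LIP(U)` is not Noetherian. -/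
theorem stmt_9 (U : Set ℤ) (hU : U.Infinite) :
    ∃ f : ℕ → ℤ → ℤ, (∀ m, IsLIP U (f m)) ∧
      (∀ m, ∃ g : ℤ → ℤ, IsLIP U g ∧ ∀ x ∈ U, f m x = f (m + 1) x * g x) ∧
      (∀ m, ¬ ∃ h : ℤ → ℤ, IsLIP U h ∧ ∀ x ∈ U, f (m + 1) x = f m x * h x) := by
  refine ⟨tailProd, isLIP_tailProd U,
    fun m => ⟨_, isLIP_eval U (ballOnePoly m), fun x _ => tailProd_eq_mul m x⟩, ?_⟩
  rintro m ⟨h, -, hh⟩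
  obtain ⟨x, hxU, hx⟩ := hU.exists_lt_natAbs m
  refine not_isUnit_eval_ballOnePoly hx (IsUnit.of_mul_eq_one (h x) ?_)
  refine mul_left_cancel₀ (tailProd_ne_zero (m + 1) x) ?_
  rw [← mul_assoc, ← tailProd_eq_mul, ← hh x hxU, mul_one]
end

section
/- If f : ℤ → ℤ is a LIP function on ℤ, then its left discrete derivative, the function x ↦ f(x) − f(x−1), is a LIP function on ℤ. -/
/-- the left discrete derivative `x ↦ f(x) − f(x−1)` of a LIP
function `f` on `ℤ` is LIP on `ℤ`. -/
theorem stmt_11 (f : ℤ → ℤ) (hf : IsLIP Set.univ f) :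
    IsLIP Set.univ (fun x => f x - f (x - 1)) := by
  intro X _
  obtain ⟨p, hp⟩ := hf (X ∪ X.image (· - 1)) (Set.subset_univ _)
  refine ⟨p - p.comp (Polynomial.X - 1), fun x hx => ?_⟩
  have h₁ := hp x (Finset.mem_union_left _ hx)
  have h₂ := hp (x - 1) (Finset.mem_union_right _ (Finset.mem_image_of_mem (· - 1) hx))
  simp [h₁, h₂]
end

section
/- Let τ : ℕ → ℝ be any sequence with τ(n) → +∞ as n → +∞. Then there exists a LIP function f : ℤ → ℤ that is not equal to any integer polynomial on ℤ, and an infinite subset X ⊆ ℤ, such that |f(x)| < |x|^{τ(|x|)} for all x ∈ X (where |x|^{τ(|x|)} denotes the real power of the absolute value of x). -/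
open Filter Polynomial in
/-- An integer polynomial is eventually dominated by `n ^ τ n` when `τ` tends to infinity. -/
theorem Polynomial.eventually_abs_eval_lt_rpow (τ : ℕ → ℝ) (hτ : Tendsto τ atTop atTop)
    (p : ℤ[X]) : ∀ᶠ n : ℕ in atTop, |((p.eval (n : ℤ) : ℤ) : ℝ)| < (n : ℝ) ^ τ n := by
  let q : ℝ[X] := p.map (Int.castRingHom ℝ)
  have hdeg : q.degree < (X ^ (q.natDegree + 1) : ℝ[X]).degree := by
    rw [degree_X_pow]
    exact degree_le_natDegree.trans_lt (by exact_mod_cast Nat.lt_succ_self _)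
  have hlim := (div_tendsto_atTop_zero_of_degree_lt q _ hdeg).comp
    (tendsto_natCast_atTop_atTop (R := ℝ))
  have hsmall := hlim.abs.eventually (gt_mem_nhds (show |(0 : ℝ)| < 1 by simp))
  filter_upwards [hsmall, hτ.eventually_ge_atTop ((q.natDegree + 1 : ℕ) : ℝ),
    eventually_ge_atTop 1] with n hn hτn h1
  have h1' : (1 : ℝ) ≤ n := by exact_mod_cast h1
  have hpos : (0 : ℝ) < (n : ℝ) ^ (q.natDegree + 1) := by positivity
  have heval : q.eval (n : ℝ) = ((p.eval (n : ℤ) : ℤ) : ℝ) := by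
    simp [q]
  simp only [Function.comp_apply, eval_pow, eval_X, abs_div, abs_of_pos hpos, heval] at hn
  rw [div_lt_one hpos] at hn
  calc _ < (n : ℝ) ^ (q.natDegree + 1) := hn
    _ = (n : ℝ) ^ ((q.natDegree + 1 : ℕ) : ℝ) := (Real.rpow_natCast _ _).symm
    _ ≤ _ := Real.rpow_le_rpow_of_exponent_le h1' hτn

open Polynomial in
/-- A polynomial can be changed off a finite set so as to differ from a given polynomial. -/
theorem Polynomial.exists_eval_eq_on_finset_and_eval_ne (p e : ℤ[X]) (S : Finset ℤ) :
    ∃ p' : ℤ[X], (∀ s ∈ S, p'.eval s = p.eval s) ∧ ∃ y, p'.eval y ≠ e.eval y := by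
  obtain ⟨y, hy⟩ := Infinite.exists_notMem_finset S
  by_cases h : p.eval y = e.eval y
  · refine ⟨p + ∏ s ∈ S, (X - C s), fun s hs => ?_, y, ?_⟩
    · simp [eval_prod, Finset.prod_eq_zero hs]
    · have : ∏ s ∈ S, (y - s) ≠ 0 :=
        Finset.prod_ne_zero_iff.2 fun s hs => sub_ne_zero.2 fun h => hy (h ▸ hs)
      simpa [eval_prod, h] using this
  · exact ⟨p, fun _ _ => rfl, y, h⟩

open Filter Polynomial in
theorem exists_polynomial_extension (τ : ℕ → ℝ) (hτ : Tendsto τ atTop atTop)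
    (e : ℤ[X]) (N : ℕ) (a : ℤ[X] × Finset ℤ) :
    ∃ b : ℤ[X] × Finset ℤ, a.2 ⊆ b.2 ∧ (∀ s ∈ a.2, b.1.eval s = a.1.eval s) ∧
      Finset.Icc (-(N : ℤ)) N ⊆ b.2 ∧ (∃ y ∈ b.2, b.1.eval y ≠ e.eval y) ∧
      ∃ x ∈ b.2, (N : ℤ) < x ∧ |((b.1.eval x : ℤ) : ℝ)| < |(x : ℝ)| ^ τ x.natAbs := by
  obtain ⟨p, hp, y, hy⟩ := exists_eval_eq_on_finset_and_eval_ne a.1 e a.2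
  obtain ⟨n, hn, hN⟩ :=
    ((eventually_abs_eval_lt_rpow τ hτ p).and (eventually_gt_atTop N)).exists
  refine ⟨(p, a.2 ∪ Finset.Icc (-(N : ℤ)) N ∪ {y, (n : ℤ)}), ?_, hp, ?_, ⟨y, by simp, hy⟩,
    n, by simp, by exact_mod_cast hN, by simpa using hn⟩
  · exact Finset.subset_union_left.trans Finset.subset_union_left
  · exact Finset.subset_union_right.trans Finset.subset_union_left

/-- for every sequence `τ : ℕ → ℝ` tending to `+∞`, there is a
non-polynomial LIP function `f` on `ℤ` and an infinite set `X ⊆ ℤ` with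
`|f(x)| < |x|^{τ(|x|)}` (real power) for all `x ∈ X`. -/
theorem stmt_12 (τ : ℕ → ℝ) (hτ : Filter.Tendsto τ Filter.atTop Filter.atTop) :
    ∃ f : ℤ → ℤ, IsLIP Set.univ f ∧
      (¬ ∃ p : Polynomial ℤ, ∀ x : ℤ, p.eval x = f x) ∧
      ∃ X : Set ℤ, X.Infinite ∧
        ∀ x ∈ X, |(f x : ℝ)| < |(x : ℝ)| ^ τ x.natAbs := by
  have : Countable (Polynomial ℤ) :=
    Cardinal.mk_le_aleph0_iff.1 (Polynomial.cardinalMk_le_max.trans (by simp))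
  obtain ⟨e, he⟩ := exists_surjective_nat (Polynomial ℤ)
  choose next hsub heq hIcc hne hsmall using
    fun N => exists_polynomial_extension τ hτ (e N) N
  let a : ℕ → Polynomial ℤ × Finset ℤ := fun n => Nat.rec (0, ∅) next n
  have hmono : Monotone fun n => (a n).2 := monotone_nat_of_le_succ fun n => hsub n (a n)
  have hstable : ∀ m n, m ≤ n → ∀ s ∈ (a m).2, (a n).1.eval s = (a m).1.eval s := by
    intro m n hmn s hs
    induction n, hmn using Nat.le_induction with
    | base => rfl
    | succ n hmn ih => exact (heq n (a n) s (hmono hmn hs)).trans ih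
  have hmem : ∀ z : ℤ, z ∈ (a (z.natAbs + 1)).2 := fun z =>
    hIcc z.natAbs (a z.natAbs) (by rw [Finset.mem_Icc]; omega)
  let f : ℤ → ℤ := fun z => (a (z.natAbs + 1)).1.eval z
  have hf : ∀ n, ∀ s ∈ (a n).2, (a n).1.eval s = f s := by
    intro n s hs
    rcases le_total n (s.natAbs + 1) with h | h
    · exact (hstable _ _ h s hs).symm
    · exact hstable _ _ h s (hmem s)
  refine ⟨f, fun X _ => ?_, ?_, {x | |(f x : ℝ)| < |(x : ℝ)| ^ τ x.natAbs}, ?_, fun x hx => hx⟩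
  · exact ⟨(a (X.sup fun z => z.natAbs + 1)).1, fun x hx =>
      hf _ x (hmono (Finset.le_sup (f := fun z : ℤ => z.natAbs + 1) hx) (hmem x))⟩
  · rintro ⟨p, hp⟩
    obtain ⟨n, rfl⟩ := he p
    obtain ⟨y, hy, hne'⟩ := hne n (a n)
    exact hne' ((hf (n + 1) y hy).trans (hp y).symm)
  · refine Set.infinite_of_forall_exists_gt fun z => ?_
    obtain ⟨x, hx, hlt, hbound⟩ := hsmall z.natAbs (a z.natAbs)
    refine ⟨x, ?_, by omega⟩
    rw [Set.mem_ofPred_eq, ← hf (z.natAbs + 1) x hx]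
    exact hbound
end

section
/- Let f be a polynomial with integer coefficients of degree exactly d. Then there exists x ∈ {0, 1, ..., d} such that |f(x)| ≥ d!/2^d. -/
/-- The alternating binomial sum of the values of a polynomial of degree `n` at `0, 1, …, n` is its
leading coefficient times `n!`. -/
theorem Polynomial.sum_alternating_choose_mul_eval {R : Type*} [CommRing R]
    (P : Polynomial R) :
    ∑ k ∈ Finset.range (P.natDegree + 1),
        (-1) ^ (P.natDegree - k) * (P.natDegree.choose k : R) * P.eval (k : R) =
      P.leadingCoeff * (P.natDegree.factorial : R) := by
  have h := congrFun P.fwdDiff_iter_degree_eq_factorial 0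
  rw [fwdDiff_iter_eq_sum_shift] at h
  simpa using h

/-- an integer polynomial of degree exactly `d` satisfies
`|f(x)| ≥ d!/2^d` for some `x ∈ {0, 1, …, d}`. -/
theorem stmt_13 (d : ℕ) (f : Polynomial ℤ) (hd : f.degree = d) :
    ∃ x : ℕ, x ≤ d ∧ (Nat.factorial d : ℚ) / 2 ^ d ≤ |((f.eval (x : ℤ) : ℤ) : ℚ)| := by
  obtain rfl : f.natDegree = d := Polynomial.natDegree_eq_of_degree_eq_some hd
  have hf : f.leadingCoeff ≠ 0 := by
    rw [Polynomial.leadingCoeff_ne_zero]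
    rintro rfl
    simp at hd
  by_contra! hlt
  have hlead : (1 : ℚ) ≤ |(f.leadingCoeff : ℚ)| := mod_cast Int.one_le_abs hf
  have hsum : (f.leadingCoeff : ℚ) * (f.natDegree.factorial : ℚ) =
      ∑ k ∈ Finset.range (f.natDegree + 1), (-1) ^ (f.natDegree - k) *
        (f.natDegree.choose k : ℚ) * ((f.eval (k : ℤ) : ℤ) : ℚ) :=
    mod_cast f.sum_alternating_choose_mul_eval.symm
  have hbound : (f.natDegree.factorial : ℚ) < f.natDegree.factorial := by
    calc (f.natDegree.factorial : ℚ)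
        ≤ |(f.leadingCoeff : ℚ)| * f.natDegree.factorial :=
          le_mul_of_one_le_left (by positivity) hlead
      _ = |(f.leadingCoeff : ℚ) * f.natDegree.factorial| := by rw [abs_mul, Nat.abs_cast]
      _ ≤ ∑ k ∈ Finset.range (f.natDegree + 1),
            (f.natDegree.choose k : ℚ) * |((f.eval (k : ℤ) : ℤ) : ℚ)| := by
          rw [hsum]
          refine (Finset.abs_sum_le_sum_abs _ _).trans_eq (Finset.sum_congr rfl fun k _ => ?_)
          simp [abs_mul]
      _ < ∑ k ∈ Finset.range (f.natDegree + 1),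
            (f.natDegree.choose k : ℚ) * (f.natDegree.factorial / 2 ^ f.natDegree) := by
          refine Finset.sum_lt_sum_of_nonempty Finset.nonempty_range_add_one fun k hk => ?_
          have hk : k ≤ f.natDegree := Finset.mem_range_succ_iff.mp hk
          exact mul_lt_mul_of_pos_left (hlt k hk) (mod_cast Nat.choose_pos hk)
      _ = f.natDegree.factorial := by
          rw [← Finset.sum_mul, ← Nat.cast_sum, Nat.sum_range_choose]
          push_cast
          field_simp
  exact lt_irrefl _ hbound
end

section
/- Let f : ℤ → ℤ be a LIP function such that for all but finitely many x ∈ ℤ one has |f(x)| < (2|x|−1)! / 2^{2|x|−1}. Then there exists a polynomial p with integer coefficients such that f(x) = p(x) for all x ∈ ℤ. -/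
open Polynomial in
theorem IsLIP.exists_degree_lt {U : Set ℤ} {f : ℤ → ℤ} (hf : IsLIP U f) (X : Finset ℤ)
    (hX : ↑X ⊆ U) : ∃ p : ℤ[X], p.degree < X.card ∧ ∀ x ∈ X, p.eval x = f x := by
  obtain ⟨p, hp⟩ := hf X hX
  have hmonic : (∏ a ∈ X, (Polynomial.X - C a)).Monic := monic_prod_X_sub_C (fun a : ℤ => a) X
  refine ⟨p %ₘ ∏ a ∈ X, (Polynomial.X - C a), ?_, fun x hx => ?_⟩
  · refine (degree_modByMonic_lt p hmonic).trans_eq ?_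
    rw [degree_eq_natDegree hmonic.ne_zero, natDegree_finsetProd_X_sub_C_eq_card]
  · have h0 : (∏ a ∈ X, (Polynomial.X - C a)).eval x = 0 := by
      rw [eval_prod]
      exact Finset.prod_eq_zero hx (by simp)
    rw [← hp x hx, modByMonic_eq_sub_mul_div, eval_sub, eval_mul, h0, zero_mul, sub_zero]

theorem Polynomial.coeff_mul_factorial_eq_sum (p : Polynomial ℤ) {k : ℕ} (hp : p.natDegree ≤ k)
    (y : ℤ) : p.coeff k * k.factorial =
      ∑ i ∈ Finset.range (k + 1), (-1) ^ (k - i) * k.choose i * p.eval (y + i) := by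
  have h := fwdDiff_iter_eq_sum_shift (1 : ℤ) (fun x => p.eval x) k y
  simp only [smul_eq_mul, nsmul_eq_mul, mul_one] at h
  rw [← h]
  rcases hp.lt_or_eq with hlt | rfl
  · rw [p.coeff_eq_zero_of_natDegree_lt hlt, p.fwdDiff_iter_eq_zero_of_degree_lt hlt]
    simp
  · rw [p.fwdDiff_iter_degree_eq_factorial]
    simp

theorem two_pow_le_two_mul_factorial (n : ℕ) : 2 ^ n ≤ 2 * n.factorial := by
  induction n with
  | zero => simp
  | succ n ih =>
    rcases n.eq_zero_or_pos with rfl | hn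
    · simp
    · rw [pow_succ, Nat.factorial_succ]
      nlinarith [Nat.factorial_pos n]

theorem factorial_mul_two_pow_le {a b m t : ℕ} (ha : 2 * m - 1 ≤ a) (ht : t ≤ b + m) :
    (2 * m - 1).factorial * 2 ^ t ≤ 4 * 2 ^ (2 * m - 1) * (a.factorial * b.factorial) := by
  have h1 : (2 * m - 1).factorial ≤ a.factorial := Nat.factorial_le ha
  have h2 : 2 ^ t ≤ 2 ^ b * 2 ^ m := by
    rw [← pow_add]
    exact Nat.pow_le_pow_right two_pos ht
  have h3 : 2 ^ m ≤ 2 * 2 ^ (2 * m - 1) := by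
    rw [← pow_succ']
    exact Nat.pow_le_pow_right two_pos (by omega)
  calc (2 * m - 1).factorial * 2 ^ t
      ≤ a.factorial * ((2 * b.factorial) * (2 * 2 ^ (2 * m - 1))) :=
        Nat.mul_le_mul h1 (h2.trans (Nat.mul_le_mul (two_pow_le_two_mul_factorial b) h3))
    _ = _ := by ring

theorem factorial_natAbs_mul_two_pow_le {k i : ℕ} (hi : i ≤ k) {m : ℕ}
    (hm : m = (-((k / 2 : ℕ) : ℤ) + i).natAbs) :
    (2 * m - 1).factorial * 2 ^ (k / 2) ≤
      4 * 2 ^ (2 * m - 1) * (i.factorial * (k - i).factorial) := by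
  rcases le_total (k / 2) i with h | h
  · exact factorial_mul_two_pow_le (by omega) (by omega)
  · rw [mul_comm i.factorial]
    exact factorial_mul_two_pow_le (by omega) (by omega)

theorem exists_forall_abs_le_mul_of_finite {α : Type*} (f g : α → ℚ) (hg : ∀ x, 0 < g x)
    (h : {x | ¬ |f x| ≤ g x}.Finite) : ∃ C : ℚ, 0 < C ∧ ∀ x, |f x| ≤ C * g x := by
  have hnn : ∀ x, 0 ≤ |f x| / g x := fun x => div_nonneg (abs_nonneg _) (hg x).le
  have hS : 0 ≤ ∑ x ∈ h.toFinset, |f x| / g x := Finset.sum_nonneg fun x _ => hnn x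
  refine ⟨1 + ∑ x ∈ h.toFinset, |f x| / g x, by linarith, fun x => ?_⟩
  by_cases hx : |f x| ≤ g x
  · nlinarith [hg x]
  · rw [← div_le_iff₀ (hg x)]
    have := Finset.single_le_sum (f := fun x => |f x| / g x) (fun x _ => hnn x)
      (h.mem_toFinset.mpr hx)
    linarith

theorem exists_forall_mul_lt_two_pow_half (C : ℚ) :
    ∃ K : ℕ, ∀ k ≥ K, C * (k + 1) < 2 ^ (k / 2) := by
  obtain ⟨B, hB⟩ := exists_nat_gt (max C 1)
  have hCB : C < B := (le_max_left _ _).trans_lt hB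
  have hB1 : (1 : ℚ) < B := (le_max_right _ _).trans_lt hB
  have hexp : ∀ n : ℕ, (n + 1) ^ 2 ≤ 8 * 2 ^ n := by
    intro n
    induction n with
    | zero => norm_num
    | succ n ih =>
      rcases lt_or_ge n 2 with hn | hn
      · interval_cases n <;> norm_num
      · rw [pow_succ 2 n]
        nlinarith
  refine ⟨32 * B, fun k hk => ?_⟩
  have hn : 16 * B ≤ k / 2 := by omega
  have hk2 : k + 1 ≤ 2 * (k / 2 + 1) := by omega
  have hnat : B * (k + 1) ≤ 2 ^ (k / 2) := by
    have := hexp (k / 2)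
    nlinarith
  calc C * (k + 1) < B * (k + 1) := by
        have : (0 : ℚ) < k + 1 := by positivity
        nlinarith
    _ ≤ 2 ^ (k / 2) := by exact_mod_cast hnat

/-- The `k + 1` consecutive integers centred at `0` (or at `1 / 2` when `k` is odd). -/
noncomputable def centeredWindow (k : ℕ) : Finset ℤ :=
  Finset.Icc (-((k / 2 : ℕ) : ℤ)) (((k + 1) / 2 : ℕ) : ℤ)

theorem mem_centeredWindow {k : ℕ} {x : ℤ} :
    x ∈ centeredWindow k ↔ -((k / 2 : ℕ) : ℤ) ≤ x ∧ x ≤ (((k + 1) / 2 : ℕ) : ℤ) :=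
  Finset.mem_Icc

theorem card_centeredWindow (k : ℕ) : (centeredWindow k).card = k + 1 := by
  rw [centeredWindow, Int.card_Icc]
  omega

theorem centeredWindow_mono : Monotone centeredWindow := fun k l hkl x hx => by
  rw [mem_centeredWindow] at hx ⊢
  omega

theorem Polynomial.coeff_eq_zero_of_abs_eval_le (p : Polynomial ℤ) {k : ℕ}
    (hp : p.natDegree ≤ k) {C : ℚ} (hk : 4 * C * (k + 1) < 2 ^ (k / 2))
    (hC : 0 < C) (hbound : ∀ x ∈ centeredWindow k, |((p.eval x : ℤ) : ℚ)| ≤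
      C * (((2 * x.natAbs - 1).factorial : ℚ) / 2 ^ (2 * x.natAbs - 1))) :
    p.coeff k = 0 := by
  set y : ℤ := -((k / 2 : ℕ) : ℤ) with hy
  have hfac : (0 : ℚ) < k.factorial := by exact_mod_cast k.factorial_pos
  have hpow : (0 : ℚ) < 2 ^ (k / 2) := by positivity
  have hterm : ∀ i ∈ Finset.range (k + 1),
      |((-1) ^ (k - i) * k.choose i * ((p.eval (y + i) : ℤ) : ℚ))| ≤
        4 * C * k.factorial / 2 ^ (k / 2) := by
    intro i hi
    have hik : i ≤ k := Nat.lt_succ_iff.mp (Finset.mem_range.mp hi)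
    have hmem : y + i ∈ centeredWindow k := by
      rw [mem_centeredWindow]
      omega
    have hfacs : (k.choose i : ℚ) * (i.factorial * (k - i).factorial) = k.factorial := by
      rw [← mul_assoc]
      exact_mod_cast Nat.choose_mul_factorial_mul_factorial hik
    obtain ⟨m, hm⟩ : ∃ m, m = (y + i).natAbs := ⟨_, rfl⟩
    have hfm : ((2 * m - 1).factorial : ℚ) * 2 ^ (k / 2) ≤
        4 * 2 ^ (2 * m - 1) * (i.factorial * (k - i).factorial) := by
      exact_mod_cast factorial_natAbs_mul_two_pow_le hik hm
    have hb := hbound _ hmem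
    rw [← hm] at hb
    have hg : ((2 * m - 1).factorial : ℚ) / 2 ^ (2 * m - 1) * 2 ^ (k / 2) ≤
        4 * (i.factorial * (k - i).factorial) := by
      rw [div_mul_eq_mul_div, div_le_iff₀ (by positivity)]
      linarith
    rw [abs_mul, abs_mul, abs_pow, abs_neg, abs_one, one_pow, one_mul, Nat.abs_cast,
      le_div_iff₀ hpow]
    calc (k.choose i : ℚ) * |((p.eval (y + i) : ℤ) : ℚ)| * 2 ^ (k / 2)
        ≤ k.choose i * (C * (((2 * m - 1).factorial : ℚ) / 2 ^ (2 * m - 1))) * 2 ^ (k / 2) := by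
          gcongr
      _ = k.choose i * C * (((2 * m - 1).factorial : ℚ) / 2 ^ (2 * m - 1) * 2 ^ (k / 2)) := by
          ring
      _ ≤ k.choose i * C * (4 * (i.factorial * (k - i).factorial)) := by gcongr
      _ = 4 * C * (k.choose i * (i.factorial * (k - i).factorial)) := by ring
      _ = 4 * C * k.factorial := by rw [hfacs]
  have hsum : ((p.coeff k : ℤ) : ℚ) * k.factorial = ∑ i ∈ Finset.range (k + 1),
      (-1) ^ (k - i) * k.choose i * ((p.eval (y + i) : ℤ) : ℚ) := by
    exact_mod_cast p.coeff_mul_factorial_eq_sum hp y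
  have habs : |((p.coeff k : ℤ) : ℚ)| * k.factorial < k.factorial := by
    calc |((p.coeff k : ℤ) : ℚ)| * k.factorial = |((p.coeff k : ℤ) : ℚ) * k.factorial| := by
          rw [abs_mul, Nat.abs_cast]
      _ ≤ (k + 1) * (4 * C * k.factorial / 2 ^ (k / 2)) := by
          rw [hsum]
          refine (Finset.abs_sum_le_sum_abs _ _).trans ?_
          simpa using Finset.sum_le_sum hterm
      _ = 4 * C * (k + 1) / 2 ^ (k / 2) * k.factorial := by ring
      _ < 1 * k.factorial := by
          gcongr
          rwa [div_lt_one hpow]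
      _ = k.factorial := one_mul _
  have hlt : |((p.coeff k : ℤ) : ℚ)| < 1 := by
    by_contra! hge
    nlinarith
  exact Int.abs_lt_one_iff.mp (by exact_mod_cast hlt)

/-- if `f` is LIP on `ℤ` and `|f(x)| < (2|x|−1)!/2^{2|x|−1}` for all
but finitely many `x ≠ 0`, then `f` is an integer polynomial. -/
theorem stmt_14 (f : ℤ → ℤ) (hf : IsLIP Set.univ f)
    (h : {x : ℤ | x ≠ 0 ∧
      ¬ (((f x).natAbs : ℚ) <
        (Nat.factorial (2 * x.natAbs - 1) : ℚ) / 2 ^ (2 * x.natAbs - 1))}.Finite) :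
    ∃ p : Polynomial ℤ, ∀ x : ℤ, p.eval x = f x := by
  obtain ⟨C, hC, hbound⟩ := exists_forall_abs_le_mul_of_finite (fun x : ℤ => (f x : ℚ))
    (fun x => ((2 * x.natAbs - 1).factorial : ℚ) / 2 ^ (2 * x.natAbs - 1))
    (fun x => by positivity) (by
      refine (h.insert 0).subset fun x hx => ?_
      refine or_iff_not_imp_left.mpr fun hx0 => ⟨hx0, fun hlt => hx ?_⟩
      rw [Nat.cast_natAbs, Int.cast_abs] at hlt
      exact hlt.le)
  obtain ⟨K, hK⟩ := exists_forall_mul_lt_two_pow_half (4 * C)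
  choose q hdeg heval using fun k => hf.exists_degree_lt (centeredWindow k) (Set.subset_univ _)
  simp only [card_centeredWindow] at hdeg
  have hstep : ∀ k, K ≤ k → q (k + 1) = q k := by
    intro k hk
    have hnat : (q (k + 1)).natDegree ≤ k + 1 :=
      Polynomial.natDegree_le_iff_coeff_eq_zero.mpr
        ((Polynomial.degree_lt_iff_coeff_zero _ _).mp (hdeg (k + 1)))
    have hcoeff : (q (k + 1)).coeff (k + 1) = 0 :=
      (q (k + 1)).coeff_eq_zero_of_abs_eval_le hnat (hK (k + 1) (by omega)) hC fun x hx => by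
        rw [heval (k + 1) x hx]
        exact hbound x
    refine Polynomial.eq_of_degrees_lt_of_eval_finset_eq (centeredWindow k) ?_ ?_ fun x hx => ?_
    · rw [card_centeredWindow, Polynomial.degree_lt_iff_coeff_zero]
      intro m hm
      rcases hm.eq_or_lt with rfl | hlt
      · exact hcoeff
      · exact Polynomial.coeff_eq_zero_of_natDegree_lt (hnat.trans_lt hlt)
    · rw [card_centeredWindow]
      exact hdeg k
    · rw [heval k x hx, heval (k + 1) x (centeredWindow_mono k.le_succ hx)]
  have hconst : ∀ k, K ≤ k → q k = q K := fun k hk => by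
    induction k, hk using Nat.le_induction with
    | base => rfl
    | succ k hk ih => rw [hstep k hk, ih]
  refine ⟨q K, fun x => ?_⟩
  rw [← hconst (K + 2 * x.natAbs) (by omega)]
  refine heval _ x (mem_centeredWindow.mpr ?_)
  omega
end

section
/- Let x_1, ..., x_n, a, b be pairwise distinct integers, and let f be a polynomial with rational coefficients of degree at most n+1 that takes integer values at x_1, ..., x_n, a, b but does not have all integer coefficients. Suppose there exists a polynomial with integer coefficients agreeing with f at all of x_1, ..., x_n, a, and there exists a polynomial with integer coefficients agreeing with f at all of x_1, ..., x_n, b. Then |a − b| ≥ 2. -/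
open Polynomial in
/-- A polynomial vanishing on a finite set is divisible by the nodal polynomial of that set. -/
theorem Lagrange.nodal_dvd_of_eval_eq_zero {R : Type*} [CommRing R] [IsDomain R]
    (s : Finset R) (p : R[X]) (hp : ∀ y ∈ s, p.eval y = 0) : Lagrange.nodal s id ∣ p := by
  rw [← modByMonic_eq_zero_iff_dvd (Lagrange.nodal_monic)]
  refine eq_zero_of_degree_lt_of_eval_finset_eq_zero s ?_ fun y hy => ?_
  · rw [← Lagrange.degree_nodal (s := s) (v := (id : R → R))]
    exact degree_modByMonic_lt _ Lagrange.nodal_monic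
  · rw [modByMonic_eq_sub_mul_div, eval_sub, eval_mul, hp y hy]
    have : (Lagrange.nodal s id).eval y = 0 := Lagrange.eval_nodal_at_node (v := id) hy
    rw [this]
    ring

open Polynomial in
/-- A rational polynomial of degree less than the size of a set of integers on which it agrees with
an integer polynomial has integer coefficients. -/
theorem Polynomial.exists_map_eq_of_eval_eq (s : Finset ℤ) (f : ℚ[X]) (r : ℤ[X])
    (hdeg : f.degree < s.card) (h : ∀ y ∈ s, ((r.eval y : ℤ) : ℚ) = f.eval (y : ℚ)) :
    ∃ g : ℤ[X], g.map (Int.castRingHom ℚ) = f := by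
  refine ⟨r %ₘ Lagrange.nodal s id, ?_⟩
  refine eq_of_degrees_lt_of_eval_index_eq s (v := fun y : ℤ => (y : ℚ))
    (Int.cast_injective.injOn) ?_ hdeg fun y hy => ?_
  · refine degree_map_le.trans_lt ?_
    rw [← Lagrange.degree_nodal (s := s) (v := (id : ℤ → ℤ))]
    exact degree_modByMonic_lt _ Lagrange.nodal_monic
  · have hy0 : (Lagrange.nodal s id).eval y = 0 := Lagrange.eval_nodal_at_node (v := id) hy
    rw [← h y hy, modByMonic_eq_sub_mul_div, eval_intCast_map, eval_sub, eval_mul, Int.cast_id,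
      hy0]
    simp


/-- if a rational polynomial `f` of degree at most `n+1` takes integer
values at the pairwise distinct integers `x_1, …, x_n, a, b`, does not have all
integer coefficients, and agrees with an integer polynomial on `{x_1, …, x_n, a}`
and with an integer polynomial on `{x_1, …, x_n, b}`, then `|a − b| ≥ 2`. -/
theorem stmt_15 (n : ℕ) (x : Fin n → ℤ) (a b : ℤ)
    (hinj : Function.Injective x) (hxa : ∀ i, x i ≠ a) (hxb : ∀ i, x i ≠ b)
    (hab : a ≠ b)
    (f : Polynomial ℚ) (hdeg : f.degree ≤ (n + 1 : ℕ))
    (hvalsx : ∀ i, ∃ m : ℤ, f.eval ((x i : ℤ) : ℚ) = (m : ℚ))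
    (hvalsa : ∃ m : ℤ, f.eval ((a : ℤ) : ℚ) = (m : ℚ))
    (hvalsb : ∃ m : ℤ, f.eval ((b : ℤ) : ℚ) = (m : ℚ))
    (hnotint : ¬ ∀ k, ∃ m : ℤ, f.coeff k = (m : ℚ))
    (hpa : ∃ p : Polynomial ℤ, (∀ i, ((p.eval (x i) : ℤ) : ℚ) = f.eval ((x i : ℤ) : ℚ)) ∧
      ((p.eval a : ℤ) : ℚ) = f.eval ((a : ℤ) : ℚ))
    (hpb : ∃ p : Polynomial ℤ, (∀ i, ((p.eval (x i) : ℤ) : ℚ) = f.eval ((x i : ℤ) : ℚ)) ∧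
      ((p.eval b : ℤ) : ℚ) = f.eval ((b : ℤ) : ℚ)) :
    2 ≤ |a - b| := by
  classical
  by_contra hlt
  obtain ⟨p, hpx, hpa⟩ := hpa
  obtain ⟨q, hqx, hqb⟩ := hpb
  set s : Finset ℤ := Finset.univ.image x with hs
  have has : a ∉ s := by simpa [hs] using hxa
  have hbs : b ∉ s := by simpa [hs] using hxb
  have hcard : (insert a (insert b s)).card = n + 2 := by
    rw [Finset.card_insert_of_notMem (by simp [hab, has]), Finset.card_insert_of_notMem hbs, hs,
      Finset.card_image_of_injective _ hinj, Finset.card_fin]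
  obtain ⟨g, hg⟩ := Lagrange.nodal_dvd_of_eval_eq_zero s (q - p) (by
    simp only [hs, Finset.mem_image, Finset.mem_univ, true_and, forall_exists_index,
      forall_apply_eq_imp_iff, Polynomial.eval_sub, sub_eq_zero]
    intro i
    exact_mod_cast (hqx i).trans (hpx i).symm)
  have hunit : (b - a) * (b - a) = 1 := by
    have h : a - b = 1 ∨ a - b = -1 := by
      rw [not_le, abs_lt] at hlt
      omega
    rcases h with h | h <;> nlinarith
  -- since `b - a` is a unit, `p` can be corrected at `b` without changing it on the other nodes
  obtain ⟨h, hh⟩ := Polynomial.exists_map_eq_of_eval_eq (insert a (insert b s)) f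
    (p + Lagrange.nodal s id * (Polynomial.X - Polynomial.C a) *
      Polynomial.C ((b - a) * g.eval b)) (by
      rw [hcard]
      exact hdeg.trans_lt (by exact_mod_cast Nat.lt_succ_self (n + 1))) (by
      intro y hy
      rw [Finset.mem_insert, Finset.mem_insert] at hy
      rcases hy with rfl | rfl | hy
      · simpa using hpa
      · rw [← hqb]
        have hgb := congrArg (Polynomial.eval y) hg
        simp only [Polynomial.eval_sub, Polynomial.eval_mul] at hgb
        simp only [Polynomial.eval_add, Polynomial.eval_mul, Polynomial.eval_sub,
          Polynomial.eval_X, Polynomial.eval_C]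
        congr 1
        linear_combination ((Lagrange.nodal s id).eval y * g.eval y) * hunit - hgb
      · have hy0 : (Lagrange.nodal s id).eval y = 0 := Lagrange.eval_nodal_at_node (v := id) hy
        obtain ⟨i, -, rfl⟩ := Finset.mem_image.mp hy
        rw [← hpx i]
        simp [hy0])
  exact hnotint fun k => ⟨h.coeff k, by simp [← hh]⟩
end

section
/- (Exchange Formula) Let X be a finite set of integers, let a and b be two distinct integers not in X, and let f be a function from X ∪ {a, b} to ℚ. For a subset S of the domain, let f_S denote the unique polynomial over ℚ of degree less than |S| that agrees with f on S (the Lagrange interpolation polynomial). Then f_{X ∪ {a}}(x) = f_{X ∪ {b}}(x) + c·(a − b)·Π_{z ∈ X} (x − z), where c is the coefficient of x^{|X|+1} in f_{X ∪ {a, b}}. -/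
open Polynomial

/-- Newton's recursion: adding a node to a Lagrange interpolation adds a multiple of the nodal
polynomial, the factor being the top coefficient of the new interpolant. -/
theorem interpolate_insert_eq_add_nodal {F ι : Type*} [Field F] [DecidableEq ι] {s : Finset ι}
    {i : ι} {v : ι → F} (hi : i ∉ s) (hv : Set.InjOn v (insert i s : Finset ι)) (r : ι → F) :
    Lagrange.interpolate (insert i s) v r = Lagrange.interpolate s v r +
      C ((Lagrange.interpolate (insert i s) v r).coeff s.card) * Lagrange.nodal s v := by
  set P := Lagrange.interpolate (insert i s) v r with hP
  have hvs : Set.InjOn v s := hv.mono (by simp)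
  have hdeg : P.degree < ((s.card + 1 : ℕ) : WithBot ℕ) := by
    simpa only [Finset.card_insert_of_notMem hi] using Lagrange.degree_interpolate_lt r hv
  have hcoeff : (Lagrange.nodal s v).coeff s.card = 1 := by
    simpa only [Monic, leadingCoeff, Lagrange.natDegree_nodal] using
      Lagrange.nodal_monic (s := s) (v := v)
  rw [← sub_eq_iff_eq_add]
  refine Lagrange.eq_interpolate_of_eval_eq r hvs ?_ fun j hj => ?_
  · rw [degree_lt_iff_coeff_zero]
    intro m hm
    rw [coeff_sub, coeff_C_mul]
    rcases hm.eq_or_lt with rfl | hm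
    · rw [hcoeff, mul_one, sub_self]
    · rw [(degree_lt_iff_coeff_zero _ _).1 hdeg m hm,
        coeff_eq_zero_of_natDegree_lt (p := Lagrange.nodal s v) (by rwa [Lagrange.natDegree_nodal]),
        mul_zero, sub_zero]
  · rw [eval_sub, eval_mul, Lagrange.eval_nodal_at_node hj, mul_zero, sub_zero, hP,
      Lagrange.eval_interpolate_at_node r hv (Finset.mem_insert_of_mem hj)]

/-- Exchange Formula: for a finite set `X ⊆ ℤ`, distinct integers
`a, b ∉ X`, and `f : X ∪ {a,b} → ℚ`, with `f_S` denoting the Lagrange interpolation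
polynomial of `f` on `S`, one has
`f_{X∪{a}} = f_{X∪{b}} + c·(a−b)·Π_{z∈X}(x−z)`, where `c` is the coefficient of
`x^{|X|+1}` in `f_{X∪{a,b}}`. -/
theorem stmt_16 (X : Finset ℤ) (a b : ℤ) (ha : a ∉ X) (hb : b ∉ X) (hab : a ≠ b)
    (f : ℤ → ℚ) :
    Lagrange.interpolate (insert a X) (fun z : ℤ => (z : ℚ)) f =
      Lagrange.interpolate (insert b X) (fun z : ℤ => (z : ℚ)) f +
        C ((Lagrange.interpolate (insert a (insert b X)) (fun z : ℤ => (z : ℚ)) f).coeff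
            (X.card + 1) * ((a : ℚ) - (b : ℚ))) *
          ∏ z ∈ X, (Polynomial.X - C (z : ℚ)) := by
  have hinj (s : Finset ℤ) : Set.InjOn (fun z : ℤ => (z : ℚ)) s := Int.cast_injective.injOn
  have h₁ := interpolate_insert_eq_add_nodal (s := insert b X) (i := a)
    (by simp [hab, ha]) (hinj _) f
  have h₂ := interpolate_insert_eq_add_nodal (s := insert a X) (i := b)
    (by simp [hab.symm, hb]) (hinj _) f
  rw [Finset.card_insert_of_notMem hb, Lagrange.nodal_insert_eq_nodal hb] at h₁
  rw [Finset.card_insert_of_notMem ha, Lagrange.nodal_insert_eq_nodal ha,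
    Finset.insert_comm b a] at h₂
  rw [← Lagrange.nodal_eq X fun z : ℤ => (z : ℚ), C_mul, C_sub]
  linear_combination h₁ - h₂
end

section
/- Let X be a finite set of integers with |X| ≥ 2 and let f : X → ℤ be a function whose interpolation polynomial f_X (the unique polynomial over ℚ of degree less than |X| agreeing with f on X) does not have all integer coefficients, but such that for every a ∈ X the interpolation polynomial of f on X \ {a} has all integer coefficients (i.e., X is a circuit for f). Then: (1) the coefficient c of x^{|X|−1} in f_X is not an integer; and (2) writing c in lowest terms with positive denominator d, all elements of X are congruent to each other modulo d. -/
open Polynomial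

/-- Newton's form of the interpolation polynomial, with respect to a removed node. -/
theorem Lagrange.interpolate_eq_interpolate_erase_add {F ι : Type*} [Field F] [DecidableEq ι]
    {s : Finset ι} {v : ι → F} (r : ι → F) (hvs : Set.InjOn v s) {i : ι} (hi : i ∈ s) :
    interpolate s v r = interpolate (s.erase i) v r +
      C ((interpolate s v r).coeff (s.card - 1)) * nodal (s.erase i) v := by
  have hcard : (s.erase i).card = s.card - 1 := Finset.card_erase_of_mem hi
  rw [← sub_eq_iff_eq_add]
  refine eq_interpolate_of_eval_eq r
    (hvs.mono (Finset.coe_subset.2 (Finset.erase_subset i s))) ?_ fun j hj => ?_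
  · rw [hcard, degree_lt_iff_coeff_zero]
    intro m hm
    rw [coeff_sub, coeff_C_mul]
    rcases hm.eq_or_lt with rfl | hlt
    · have hlead : (nodal (s.erase i) v).coeff (s.card - 1) = 1 := by
        rw [← hcard, ← natDegree_nodal (s := s.erase i) (v := v)]
        exact nodal_monic
      rw [hlead, mul_one, sub_self]
    · have hP : (interpolate s v r).coeff m = 0 :=
        coeff_eq_zero_of_degree_lt ((degree_interpolate_lt r hvs).trans_le
          (Nat.cast_le.2 (by omega)))
      have hN : (nodal (s.erase i) v).coeff m = 0 :=
        coeff_eq_zero_of_natDegree_lt (by rw [natDegree_nodal]; omega)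
      rw [hP, hN, mul_zero, sub_zero]
  · rw [eval_sub, eval_mul, eval_nodal_at_node hj, mul_zero, sub_zero,
      eval_interpolate_at_node r hvs (Finset.mem_of_mem_erase hj)]

theorem Lagrange.coeff_nodal_intCast (s : Finset ℤ) (k : ℕ) :
    (nodal s (fun z : ℤ => (z : ℚ))).coeff k = ((nodal s id).coeff k : ℤ) := by
  have h : nodal s (fun z : ℤ => (z : ℚ)) = (nodal s id).map (Int.castRingHom ℚ) := by
    simp [nodal_eq, Polynomial.map_prod]
  rw [h, coeff_map, eq_intCast]

theorem Rat.den_dvd_of_mul_intCast_eq {q : ℚ} {n m : ℤ} (h : q * n = m) : (q.den : ℤ) ∣ n := by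
  have hmul : q.num * n = q.den * m := by
    have : (q.num : ℚ) * n = q.den * m := by rw [← h, ← Rat.mul_den_eq_num q]; ring
    exact_mod_cast this
  have hcop : IsCoprime (q.den : ℤ) q.num :=
    (Rat.isCoprime_num_den q).symm
  exact hcop.dvd_of_dvd_mul_left ⟨m, hmul⟩

/-- suppose `X ⊆ ℤ` is finite with `|X| ≥ 2` and `f : X → ℤ` is such
that its Lagrange interpolation polynomial `f_X` does not have all integer
coefficients, while `f_{X∖{a}}` has all integer coefficients for every `a ∈ X`
(`X` is a circuit for `f`). Then the coefficient `c` of `x^{|X|−1}` in `f_X` is not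
an integer, and all elements of `X` are congruent modulo the denominator of `c`. -/
theorem stmt_17 (X : Finset ℤ) (hcard : 2 ≤ X.card) (f : ℤ → ℤ)
    (hX : ¬ ∀ k, ∃ m : ℤ,
      (Lagrange.interpolate X (fun z : ℤ => (z : ℚ)) (fun z => (f z : ℚ))).coeff k = (m : ℚ))
    (herase : ∀ a ∈ X, ∀ k, ∃ m : ℤ,
      (Lagrange.interpolate (X.erase a) (fun z : ℤ => (z : ℚ))
        (fun z => (f z : ℚ))).coeff k = (m : ℚ)) :
    (¬ ∃ m : ℤ,
      (Lagrange.interpolate X (fun z : ℤ => (z : ℚ)) (fun z => (f z : ℚ))).coeff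
        (X.card - 1) = (m : ℚ)) ∧
    (∀ a ∈ X, ∀ b ∈ X,
      (((Lagrange.interpolate X (fun z : ℤ => (z : ℚ)) (fun z => (f z : ℚ))).coeff
        (X.card - 1)).den : ℤ) ∣ (a - b)) := by
  have hinj : Set.InjOn (fun z : ℤ => (z : ℚ)) X := Int.cast_injective.injOn
  have hnewton := fun a (ha : a ∈ X) =>
    Lagrange.interpolate_eq_interpolate_erase_add (fun z => (f z : ℚ)) hinj ha
  set P := Lagrange.interpolate X (fun z : ℤ => (z : ℚ)) (fun z => (f z : ℚ))
  set c := P.coeff (X.card - 1)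
  refine ⟨?_, fun a ha b hb => ?_⟩
  · rintro ⟨m, hm⟩
    obtain ⟨a, ha⟩ : X.Nonempty := Finset.card_pos.1 (by omega)
    refine hX fun k => ?_
    obtain ⟨l, hl⟩ := herase a ha k
    refine ⟨l + m * (Lagrange.nodal (X.erase a) id).coeff k, ?_⟩
    rw [hnewton a ha, coeff_add, coeff_C_mul, hl, hm, Lagrange.coeff_nodal_intCast]
    push_cast
    rfl
  · rcases eq_or_ne a b with rfl | hab
    · simp
    obtain ⟨l, hl⟩ := herase a ha (X.card - 2)
    obtain ⟨m, hm⟩ := herase b hb (X.card - 2)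
    have hcoeff := congrArg (fun p => p.coeff (X.card - 2))
      ((hnewton a ha).symm.trans (hnewton b hb))
    simp only [coeff_add, coeff_C_mul, hl, hm, Lagrange.coeff_nodal_intCast] at hcoeff
    have hnodal : (Lagrange.nodal (X.erase a) id).coeff (X.card - 2) -
        (Lagrange.nodal (X.erase b) id).coeff (X.card - 2) = a - b := by
      have hba : b ∈ X.erase a := Finset.mem_erase.2 ⟨hab.symm, hb⟩
      have hab' : a ∈ X.erase b := Finset.mem_erase.2 ⟨hab, ha⟩
      have hlead : (Lagrange.nodal ((X.erase a).erase b) (id : ℤ → ℤ)).coeff (X.card - 2) = 1 := by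
        have hcard : ((X.erase a).erase b).card = X.card - 2 := by
          rw [Finset.card_erase_of_mem hba, Finset.card_erase_of_mem ha, Nat.sub_sub]
        rw [← hcard, ← Lagrange.natDegree_nodal (s := (X.erase a).erase b) (v := (id : ℤ → ℤ))]
        exact Lagrange.nodal_monic
      have hdiff : Lagrange.nodal (X.erase a) (id : ℤ → ℤ) - Lagrange.nodal (X.erase b) id =
          C (a - b) * Lagrange.nodal ((X.erase a).erase b) id := by
        rw [Lagrange.nodal_eq_mul_nodal_erase hba, Lagrange.nodal_eq_mul_nodal_erase hab',
          Finset.erase_right_comm (a := b), C_sub]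
        simp only [id]
        ring
      rw [← coeff_sub, hdiff, coeff_C_mul, hlead, mul_one]
    refine Rat.den_dvd_of_mul_intCast_eq (m := m - l) ?_
    rw [← hnodal]
    push_cast
    linear_combination hcoeff
end

section
/- Let U_1 = {a_1 + k·d_1 : k ∈ ℤ, k ≥ 0} and U_2 = {a_2 + k·d_2 : k ∈ ℤ, k ≥ 0} be two infinite arithmetic progressions of natural numbers (a_1, a_2, d_1, d_2 natural numbers with d_1, d_2 ≥ 1) with U_1 ∩ U_2 nonempty. If f : U_1 ∪ U_2 → ℤ is a function whose restriction to U_1 is LIP and whose restriction to U_2 is LIP, then f is LIP on U_1 ∪ U_2. -/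
open Polynomial in
/-- Some nonzero multiple of every integer function on a finite set of integers is
interpolated by an integer polynomial, uniformly in the function. -/
theorem exists_ne_zero_forall_eval_eq_mul (X : Finset ℤ) :
    ∃ M : ℤ, M ≠ 0 ∧ ∀ h : ℤ → ℤ, ∃ q : ℤ[X], ∀ x ∈ X, q.eval x = M * h x := by
  induction X using Finset.induction_on with
  | empty => exact ⟨1, one_ne_zero, fun h => ⟨0, by simp⟩⟩
  | insert a X ha ih =>
    obtain ⟨M, hM, H⟩ := ih
    set P : ℤ[X] := ∏ x ∈ X, (Polynomial.X - C x) with hP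
    have hPa : P.eval a ≠ 0 := by
      rw [hP, eval_prod, Finset.prod_ne_zero_iff]
      intro x hx
      simp only [eval_sub, eval_X, eval_C]
      exact sub_ne_zero.2 fun h => ha (h ▸ hx)
    have hPx : ∀ x ∈ X, P.eval x = 0 := by
      intro x hx
      rw [hP, eval_prod]
      exact Finset.prod_eq_zero hx (by simp)
    refine ⟨M * P.eval a, mul_ne_zero hM hPa, fun h => ?_⟩
    obtain ⟨q, hq⟩ := H h
    refine ⟨C (P.eval a) * q + C (M * h a - q.eval a) * P, fun x hx => ?_⟩
    simp only [eval_add, eval_mul, eval_C]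
    rcases Finset.mem_insert.1 hx with rfl | hx
    · ring
    · rw [hPx x hx, hq x hx]
      ring

/-- A function on a finite set is given by an integer polynomial as soon as, for every prime `p`,
some multiple of it by an integer prime to `p` is. -/
theorem exists_eval_eq_of_forall_prime (X : Finset ℤ) (f : ℤ → ℤ)
    (H : ∀ p : ℕ, p.Prime → ∃ m : ℤ, ¬ (p : ℤ) ∣ m ∧
      ∃ q : Polynomial ℤ, ∀ x ∈ X, q.eval x = m * f x) :
    ∃ q : Polynomial ℤ, ∀ x ∈ X, q.eval x = f x := by
  let I : Ideal ℤ :=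
    { carrier := {m | ∃ q : Polynomial ℤ, ∀ x ∈ X, q.eval x = m * f x}
      zero_mem' := ⟨0, by simp⟩
      add_mem' := by
        rintro a b ⟨q, hq⟩ ⟨r, hr⟩
        exact ⟨q + r, fun x hx => by rw [Polynomial.eval_add, hq x hx, hr x hx, add_mul]⟩
      smul_mem' := by
        rintro c a ⟨q, hq⟩
        refine ⟨Polynomial.C c * q, fun x hx => ?_⟩
        rw [Polynomial.eval_mul, Polynomial.eval_C, hq x hx, smul_eq_mul, mul_assoc] }
  obtain ⟨g, hg⟩ := (IsPrincipalIdealRing.principal I).principal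
  have hmem : ∀ m, m ∈ I ↔ g ∣ m := fun m => by
    rw [hg]
    exact Ideal.mem_span_singleton
  have hunit : g.natAbs = 1 := by
    by_contra hne
    obtain ⟨p, hp, hpg⟩ := Nat.exists_prime_and_dvd hne
    obtain ⟨m, hm, hq⟩ := H p hp
    exact hm ((Int.natCast_dvd.2 hpg).trans ((hmem m).1 hq))
  obtain ⟨q, hq⟩ := (hmem 1).2 (Int.isUnit_iff_natAbs_eq.2 hunit).dvd
  exact ⟨q, fun x hx => by rw [hq x hx, one_mul]⟩

/-- If every point of a finite set `X` can be approximated `p`-adically from `U`, together with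
the value of `f`, then a prime-to-`p` multiple of `f` is an integer polynomial on `X`. -/
theorem IsLIP.exists_not_dvd_eval_eq_mul {U : Set ℤ} {f : ℤ → ℤ} (hf : IsLIP U f)
    {p : ℕ} (hp : p.Prime) (X : Finset ℤ)
    (H : ∀ N : ℕ, ∀ x ∈ X, ∃ y ∈ U, (p : ℤ) ^ N ∣ x - y ∧ (p : ℤ) ^ N ∣ f x - f y) :
    ∃ m : ℤ, ¬ (p : ℤ) ∣ m ∧ ∃ q : Polynomial ℤ, ∀ x ∈ X, q.eval x = m * f x := by
  obtain ⟨M, hM, hinterp⟩ := exists_ne_zero_forall_eval_eq_mul X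
  have hfin : FiniteMultiplicity (p : ℤ) M :=
    Int.finiteMultiplicity_iff.2 ⟨by simpa using hp.ne_one, hM⟩
  obtain ⟨m, hMm, hm⟩ := hfin.exists_eq_pow_mul_and_not_dvd
  generalize multiplicity (p : ℤ) M = N at hMm
  choose! y hyU hxy hfxy using H N
  obtain ⟨q, hq⟩ := hf (X.image y) (by
    intro z hz
    obtain ⟨x, hx, rfl⟩ := Finset.mem_image.1 (Finset.mem_coe.1 hz)
    exact hyU x hx)
  have hdvd : ∀ x ∈ X, (p : ℤ) ^ N ∣ f x - q.eval x := by
    intro x hx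
    have h₁ : (p : ℤ) ^ N ∣ q.eval x - q.eval (y x) :=
      (hxy x hx).trans (Polynomial.sub_dvd_eval_sub x (y x) q)
    rw [hq (y x) (Finset.mem_image_of_mem y hx)] at h₁
    have h₂ := dvd_sub (hfxy x hx) h₁
    rwa [sub_sub_sub_cancel_right] at h₂
  choose! h hh using hdvd
  obtain ⟨r, hr⟩ := hinterp h
  refine ⟨m, hm, Polynomial.C m * q + r, fun x hx => ?_⟩
  rw [Polynomial.eval_add, Polynomial.eval_mul, Polynomial.eval_C, hr x hx, hMm]
  linear_combination -m * hh x hx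

/-- Let `p ∤ m` and `p ^ e ∣ d₂`. If the progressions `a₁ + ℕ p ^ e m` and `a₂ + ℕ d₂` meet, then
their intersection is `p`-adically dense in the second one. -/
theorem exists_mem_progressions_pow_dvd_sub {p : ℕ} (hp : p.Prime) {a₁ a₂ d₂ e m : ℕ}
    (hm : ¬ p ∣ m) (he : p ^ e ∣ d₂) {c : ℤ}
    (hc₁ : ∃ k : ℕ, c = (a₁ : ℤ) + (k : ℤ) * ((p ^ e * m : ℕ) : ℤ))
    (hc₂ : ∃ k : ℕ, c = (a₂ : ℤ) + (k : ℤ) * (d₂ : ℤ)) (N : ℕ) {x : ℤ}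
    (hx : ∃ k : ℕ, x = (a₂ : ℤ) + (k : ℤ) * (d₂ : ℤ)) :
    ∃ y : ℤ, (∃ k : ℕ, y = (a₁ : ℤ) + (k : ℤ) * ((p ^ e * m : ℕ) : ℤ)) ∧
      (∃ k : ℕ, y = (a₂ : ℤ) + (k : ℤ) * (d₂ : ℤ)) ∧ (p : ℤ) ^ N ∣ x - y := by
  obtain ⟨k₁, hk₁⟩ := hc₁
  obtain ⟨k₂, hk₂⟩ := hc₂
  obtain ⟨k, rfl⟩ := hx
  obtain ⟨b, rfl⟩ := he
  have hcop : IsCoprime (m : ℤ) ((p : ℤ) ^ N) :=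
    (Nat.isCoprime_iff_coprime.2 ((hp.coprime_iff_not_dvd.2 hm).symm)).pow_right
  obtain ⟨u, v, huv⟩ := hcop
  have hpos : (0 : ℤ) < (p : ℤ) ^ N := by
    have := hp.pos
    positivity
  obtain ⟨s, hs⟩ := Int.eq_ofNat_of_zero_le
    (Int.emod_nonneg (u * ((k : ℤ) - k₂)) hpos.ne')
  have hs' := Int.emod_add_mul_ediv (u * ((k : ℤ) - k₂)) ((p : ℤ) ^ N)
  rw [hs] at hs'
  refine ⟨c + s * (p ^ e * b * m), ⟨k₁ + s * b, ?_⟩, ⟨k₂ + s * m, ?_⟩, ?_⟩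
  · rw [hk₁]
    push_cast
    ring
  · rw [hk₂]
    push_cast
    ring
  · refine ⟨p ^ e * b * (v * (k - k₂) + m * (u * ((k : ℤ) - k₂) / (p : ℤ) ^ N)), ?_⟩
    rw [hk₂]
    push_cast
    linear_combination (-(p : ℤ) ^ e * b * (k - k₂)) * huv - (p : ℤ) ^ e * b * m * hs'

/-- A function that is LIP on two intersecting progressions becomes, on any finite subset of their
union, an integer polynomial after multiplication by an integer prime to `p`, provided that the
`p`-part of the first common difference divides the second. -/
theorem IsLIP.exists_not_dvd_eval_eq_mul_of_progressions {p : ℕ} (hp : p.Prime)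
    {a₁ a₂ d₂ e m : ℕ} (hm : ¬ p ∣ m) (he : p ^ e ∣ d₂) {U₁ U₂ : Set ℤ}
    (hU₁ : U₁ = {x : ℤ | ∃ k : ℕ, x = (a₁ : ℤ) + (k : ℤ) * ((p ^ e * m : ℕ) : ℤ)})
    (hU₂ : U₂ = {x : ℤ | ∃ k : ℕ, x = (a₂ : ℤ) + (k : ℤ) * (d₂ : ℤ)})
    (hmeet : (U₁ ∩ U₂).Nonempty) {f : ℤ → ℤ} (hf₁ : IsLIP U₁ f) (hf₂ : IsLIP U₂ f)
    {X : Finset ℤ} (hX : ↑X ⊆ U₁ ∪ U₂) :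
    ∃ n : ℤ, ¬ (p : ℤ) ∣ n ∧ ∃ q : Polynomial ℤ, ∀ x ∈ X, q.eval x = n * f x := by
  refine hf₁.exists_not_dvd_eval_eq_mul hp X fun N x hx => ?_
  rcases hX hx with hx₁ | hx₂
  · exact ⟨x, hx₁, by simp, by simp⟩
  · obtain ⟨c, hc₁, hc₂⟩ := hmeet
    obtain ⟨y, hy₁, hy₂, hxy⟩ := exists_mem_progressions_pow_dvd_sub hp (a₁ := a₁) (a₂ := a₂)
      hm he (hU₁ ▸ hc₁ :) (hU₂ ▸ hc₂ :) N (hU₂ ▸ hx₂ :)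
    exact ⟨y, hU₁ ▸ hy₁, hxy, hxy.trans (hf₂.sub_dvd_sub hx₂ (hU₂ ▸ hy₂))⟩

/-- if `U₁` and `U₂` are two intersecting infinite arithmetic
progressions of natural numbers and `f : U₁ ∪ U₂ → ℤ` restricts to a LIP function on
each of `U₁` and `U₂`, then `f` is LIP on `U₁ ∪ U₂`. -/
theorem stmt_19 (a₁ a₂ d₁ d₂ : ℕ) (hd₁ : 1 ≤ d₁) (hd₂ : 1 ≤ d₂)
    (U₁ U₂ : Set ℤ)
    (hU₁ : U₁ = {x : ℤ | ∃ k : ℕ, x = (a₁ : ℤ) + (k : ℤ) * (d₁ : ℤ)})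
    (hU₂ : U₂ = {x : ℤ | ∃ k : ℕ, x = (a₂ : ℤ) + (k : ℤ) * (d₂ : ℤ)})
    (hmeet : (U₁ ∩ U₂).Nonempty)
    (f : ℤ → ℤ) (hf₁ : IsLIP U₁ f) (hf₂ : IsLIP U₂ f) :
    IsLIP (U₁ ∪ U₂) f := by
  intro X hX
  refine exists_eval_eq_of_forall_prime X f fun p hp => ?_
  obtain ⟨e₁, m₁, hm₁, rfl⟩ := Nat.exists_eq_pow_mul_and_not_dvd
    (Nat.one_le_iff_ne_zero.1 hd₁) p hp.ne_one
  obtain ⟨e₂, m₂, hm₂, rfl⟩ := Nat.exists_eq_pow_mul_and_not_dvd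
    (Nat.one_le_iff_ne_zero.1 hd₂) p hp.ne_one
  rcases le_total e₁ e₂ with h | h
  · exact IsLIP.exists_not_dvd_eval_eq_mul_of_progressions hp hm₁
      ((pow_dvd_pow p h).mul_right m₂) hU₁ hU₂ hmeet hf₁ hf₂ hX
  · exact IsLIP.exists_not_dvd_eval_eq_mul_of_progressions hp hm₂
      ((pow_dvd_pow p h).mul_right m₁) hU₂ hU₁ (Set.inter_comm U₁ U₂ ▸ hmeet) hf₂ hf₁
      (Set.union_comm U₁ U₂ ▸ hX)
end
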